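/- Let A and B be coaugmented chain coalgebras over a commutative ring R of characteristic 2. The natural degree +1 map h on Ω(A⊗B) is a chain homotopy from σq to the identity: dh + hd = σq + 1 on all of Ω(A⊗B), where q is the Milgram map and σ its natural section. -/

import Mathlib

open scoped TensorProduct
open DirectSum

noncomputable section
namespace CJ2

/-- Cast along an equality of indices in a graded module. -/
def pcast {R : Type} [CommRing R] {A : ℕ → Type} [∀ n, AddCommGroup (A n)]
    [∀ n, Module R (A n)] {m n : ℕ} (h : m = n) : A m →ₗ[R] A n where
  toFun x := h ▸ x
  map_add' := by subst h; intros; rfl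
  map_smul' := by subst h; intros; rfl

/-- A coaugmented chain coalgebra over `R`, presented componentwise: a non-negatively
graded `R`-module `A` with differential `d` of degree `-1`, comultiplication given by
its components `comul p q : A (p+q) → A p ⊗ A q`, counit and coaugmentation, subject to
the usual axioms (coassociativity, counit laws, co-Leibniz rule, `d² = 0`). -/
structure CoalgStr (R : Type) [CommRing R] (A : ℕ → Type)
    [∀ n, AddCommGroup (A n)] [∀ n, Module R (A n)] where
  d : ∀ n, A (n+1) →ₗ[R] A n
  dd : ∀ (n : ℕ) (x : A (n+2)), d n (d (n+1) x) = 0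
  comul : ∀ p q, A (p+q) →ₗ[R] (A p ⊗[R] A q)
  counit : A 0 →ₗ[R] R
  coaug : R →ₗ[R] A 0
  counit_coaug : counit (coaug 1) = 1
  coaug_grouplike : comul 0 0 (coaug 1) = coaug 1 ⊗ₜ[R] coaug 1
  comul_counit : ∀ (n : ℕ) (x : A n),
    TensorProduct.rid R (A n) ((TensorProduct.map LinearMap.id counit) (comul n 0 x)) = x
  counit_comul : ∀ (n : ℕ) (x : A n),
    TensorProduct.lid R (A n) ((TensorProduct.map counit LinearMap.id)
      (comul 0 n (pcast (R := R) (A := A) (Nat.zero_add n).symm x))) = x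
  coassoc : ∀ (p q r : ℕ) (x : A (p+q+r)),
    TensorProduct.assoc R (A p) (A q) (A r)
        ((TensorProduct.map (comul p q) LinearMap.id) (comul (p+q) r x))
      = (TensorProduct.map LinearMap.id (comul q r)) (comul p (q+r) (pcast (R := R) (A := A) (Nat.add_assoc p q r) x))
  coleib : ∀ (p q : ℕ) (x : A (p+q+1)),
    comul p q (d (p+q) x)
      = (TensorProduct.map (d p) LinearMap.id) (comul (p+1) q (pcast (R := R) (A := A) (by omega) x))
        + ((-1 : ℤ)^p) • (TensorProduct.map LinearMap.id (d q)) (comul p (q+1) (pcast (R := R) (A := A) (by omega) x))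
  counit_d : ∀ x : A 1, counit (d 0 x) = 0

section Setup

variable {R : Type} [CommRing R]
variable (A : ℕ → Type) [∀ n, AddCommGroup (A n)] [∀ n, Module R (A n)] (CA : CoalgStr R A)

/-- The reduced part `Ā` of a coaugmented chain coalgebra:
`ker ε` in degree 0, everything in positive degree. -/
def redT : ℕ → Type
  | 0 => ↥(LinearMap.ker CA.counit)
  | n+1 => A (n+1)

instance redT.acg : ∀ n, AddCommGroup (redT A CA n)
  | 0 => inferInstanceAs (AddCommGroup ↥(LinearMap.ker CA.counit))
  | n+1 => inferInstanceAs (AddCommGroup (A (n+1)))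

instance redT.mod : ∀ n, Module R (redT A CA n)
  | 0 => inferInstanceAs (Module R ↥(LinearMap.ker CA.counit))
  | n+1 => inferInstanceAs (Module R (A (n+1)))

/-- The total module of the reduced coalgebra `Ā`. -/
abbrev Big := ⨁ n, redT A CA n

/-- Reduction `A n → Ā n`: in degree 0 it kills the coaugmentation
(`x ↦ x - η(ε x)`), in positive degrees the identity. -/
def toRed : ∀ n, A n →ₗ[R] redT A CA n
  | 0 => LinearMap.codRestrict (LinearMap.ker CA.counit)
      (LinearMap.id - CA.coaug ∘ₗ CA.counit)
      (fun x => by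
        have h1 : CA.coaug (CA.counit x) = CA.counit x • CA.coaug 1 := by
          rw [← map_smul, smul_eq_mul, mul_one]
        simp only [LinearMap.mem_ker, LinearMap.sub_apply, LinearMap.id_apply,
          LinearMap.coe_comp, Function.comp_apply, map_sub, h1, map_smul,
          CA.counit_coaug, smul_eq_mul, mul_one, sub_self])
  | n+1 => LinearMap.id

/-- The embedding of a homogeneous component of `A` into `Ā`
(killing the coaugmentation in degree 0). -/
def embT (n : ℕ) : A n →ₗ[R] Big A CA :=
  (DirectSum.lof R ℕ (redT A CA) n).comp (toRed A CA n)

/-- The degree-0 "counit" of the component `A q` (the counit for `q = 0`, else `0`). -/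
def epsAt : ∀ q, A q →ₗ[R] R
  | 0 => CA.counit
  | _+1 => 0

/-- The value of the reduced diagonal `Δ̄` on a homogeneous element,
as an element of `Ā ⊗ Ā` (the embeddings kill the primitive terms). -/
def bigDiag (p : ℕ) : A p →ₗ[R] (Big A CA ⊗[R] Big A CA) :=
  ∑ j : Fin (p+1),
    (TensorProduct.map (embT A CA j.1) (embT A CA (p - j.1))).comp
      ((CA.comul j.1 (p - j.1)).comp (pcast (R := R) (A := A) (by have := j.is_le; omega)))

end Setup

section TwoCoalgebras

variable {R : Type} [CommRing R]
variable (A : ℕ → Type) [∀ n, AddCommGroup (A n)] [∀ n, Module R (A n)] (CA : CoalgStr R A)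
variable (B : ℕ → Type) [∀ n, AddCommGroup (B n)] [∀ n, Module R (B n)] (CB : CoalgStr R B)

/-- The module of generators of `Ω (A ⊗ B)`: the reduced part
`(A ⊗ B)‾ = (Ā ⊗ B̄) ⊕ Ā ⊕ B̄`. -/
abbrev WW := (Big A CA ⊗[R] Big B CB) × Big A CA × Big B CB

/-- The underlying algebra of the cobar construction `Ω (A ⊗ B)`. -/
abbrev Om := TensorAlgebra R (WW A CA B CB)

/-- The underlying algebra of `Ω A`. -/
abbrev OmA := TensorAlgebra R (Big A CA)

/-- The underlying algebra of `Ω B`. -/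
abbrev OmB := TensorAlgebra R (Big B CB)

/-- The letter `[a]`, `a ∈ Ā`. -/
def lA : Big A CA →ₗ[R] WW A CA B CB := LinearMap.prod 0 (LinearMap.prod LinearMap.id 0)

/-- The letter `[b]`, `b ∈ B̄`. -/
def lB : Big B CB →ₗ[R] WW A CA B CB := LinearMap.prod 0 (LinearMap.prod 0 LinearMap.id)

/-- The letter `[ab]`, `a ∈ Ā`, `b ∈ B̄`. -/
def lT : (Big A CA ⊗[R] Big B CB) →ₗ[R] WW A CA B CB := LinearMap.prod LinearMap.id 0

/-- The length-one word `[a]` in `Ω (A ⊗ B)`. -/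
def genA (x : Big A CA) : Om A CA B CB := TensorAlgebra.ι R (lA A CA B CB x)

/-- The length-one word `[b]` in `Ω (A ⊗ B)`. -/
def genB (y : Big B CB) : Om A CA B CB := TensorAlgebra.ι R (lB A CA B CB y)

/-- The length-one word `[ab]` in `Ω (A ⊗ B)`. -/
def genT (t : Big A CA ⊗[R] Big B CB) : Om A CA B CB := TensorAlgebra.ι R (lT A CA B CB t)

/-- The generator of `Ω(A⊗B)` corresponding to a homogeneous element of `A_p ⊗ B_q`
(decomposed into its `[āb̄]`, `[ā]`, `[b̄]` parts). -/
def Γg (p q : ℕ) : (A p ⊗[R] B q) →ₗ[R] WW A CA B CB :=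
  LinearMap.prod (TensorProduct.map (embT A CA p) (embT B CB q))
    (LinearMap.prod
      ((embT A CA p).comp ((TensorProduct.rid R (A p)).toLinearMap.comp
        (TensorProduct.map LinearMap.id (epsAt B CB q))))
      ((embT B CB q).comp ((TensorProduct.lid R (B q)).toLinearMap.comp
        (TensorProduct.map (epsAt A CA p) LinearMap.id))))

/-- The length-one word of `Ω (A ⊗ B)` on a homogeneous element of `A_p ⊗ B_q`. -/
def genW (p q : ℕ) (z : A p ⊗[R] B q) : Om A CA B CB :=
  TensorAlgebra.ι R (Γg A CA B CB p q z)

/-- The generator values of the Milgram map: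
`[a ⊗ 1] ↦ [a] ⊗ [ ]`, `[1 ⊗ b] ↦ [ ] ⊗ [b]`, `[a ⊗ b] ↦ 0`. -/
def qgen : WW A CA B CB →ₗ[R] (OmA A CA ⊗[R] OmB B CB) :=
  ((TensorProduct.mk R (OmA A CA) (OmB B CB)).flip 1).comp
      ((TensorAlgebra.ι R).comp
        ((LinearMap.fst R (Big A CA) (Big B CB)).comp
          (LinearMap.snd R (Big A CA ⊗[R] Big B CB) (Big A CA × Big B CB))))
  + (TensorProduct.mk R (OmA A CA) (OmB B CB) 1).comp
      ((TensorAlgebra.ι R).comp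
        ((LinearMap.snd R (Big A CA) (Big B CB)).comp
          (LinearMap.snd R (Big A CA ⊗[R] Big B CB) (Big A CA × Big B CB))))

/-- The Milgram map `q : Ω (A ⊗ B) → Ω A ⊗ Ω B`. -/
def qMil : Om A CA B CB →ₐ[R] (OmA A CA ⊗[R] OmB B CB) :=
  TensorAlgebra.lift R (qgen A CA B CB)

/-- `Ω i_A : Ω A → Ω (A ⊗ B)`. -/
def OiA : OmA A CA →ₐ[R] Om A CA B CB :=
  TensorAlgebra.lift R ((TensorAlgebra.ι R).comp (lA A CA B CB))

/-- `Ω i_B : Ω B → Ω (A ⊗ B)`. -/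
def OiB : OmB B CB →ₐ[R] Om A CA B CB :=
  TensorAlgebra.lift R ((TensorAlgebra.ι R).comp (lB A CA B CB))

/-- The natural section `σ : Ω A ⊗ Ω B → Ω (A ⊗ B)`,
`σ (u ⊗ v) = Ω i_A (u) · Ω i_B (v)`. -/
def sigmaMil : (OmA A CA ⊗[R] OmB B CB) →ₗ[R] Om A CA B CB :=
  TensorProduct.lift ((LinearMap.mul R (Om A CA B CB)).compl₁₂
    (OiA A CA B CB).toLinearMap (OiB A CA B CB).toLinearMap)

/-- Bilinear multiplication helper: `(m ⊗ n) ↦ f m * g n`. -/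
def mul2 {M N P : Type} [AddCommGroup M] [Module R M] [AddCommGroup N] [Module R N]
    [Ring P] [Algebra R P] (f : M →ₗ[R] P) (g : N →ₗ[R] P) : (M ⊗[R] N) →ₗ[R] P :=
  TensorProduct.lift ((LinearMap.mul R P).compl₁₂ f g)

/-- The word in `Ω (A ⊗ B)` given by a list of homogeneous letters from `Ā`. -/
def wordA (l : List ((p : ℕ) × A p)) : Om A CA B CB :=
  (l.map fun t => genA A CA B CB (embT A CA t.1 t.2)).prod

/-- The word in `Ω (A ⊗ B)` given by a list of homogeneous letters from `B̄`. -/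
def wordB (l : List ((q : ℕ) × B q)) : Om A CA B CB :=
  (l.map fun t => genB A CA B CB (embT B CB t.1 t.2)).prod

/-- The word in `Ω (A ⊗ B)` given by a list of general homogeneous letters. -/
def wordW (l : List ((pq : ℕ × ℕ) × (A pq.1 ⊗[R] B pq.2))) : Om A CA B CB :=
  (l.map fun t => genW A CA B CB t.1.1 t.1.2 t.2).prod

/-- Parity of the cobar degree of a word of `Ā`-letters. -/
def degA (l : List ((p : ℕ) × A p)) : ℕ := (l.map fun t => t.1).sum + l.length

/-- Parity of the cobar degree of a word of general letters. -/
def degW (l : List ((pq : ℕ × ℕ) × (A pq.1 ⊗[R] B pq.2))) : ℕ :=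
  (l.map fun t => t.1.1 + t.1.2).sum + l.length

/-- The Sweedler-type operation `(b₁ ⊗ b₂) ↦ h([b₁ | α]) · [a b₂]`. -/
def sweedC (h : Om A CA B CB →ₗ[R] Om A CA B CB) (α : List ((p : ℕ) × A p))
    (x : Big A CA) : (Big B CB ⊗[R] Big B CB) →ₗ[R] Om A CA B CB :=
  TensorProduct.lift ((LinearMap.mul R (Om A CA B CB)).compl₁₂
    (h ∘ₗ (LinearMap.mulRight R (wordA A CA B CB α)) ∘ₗ (TensorAlgebra.ι R) ∘ₗ lB A CA B CB)
    ((TensorAlgebra.ι R) ∘ₗ (lT A CA B CB) ∘ₗ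
      (TensorProduct.mk R (Big A CA) (Big B CB) x)))

/-- The Sweedler-type operation `(b₁ ⊗ b₂) ↦ [a b₁] · h([b₂ | α])`. -/
def sweedC2 (h : Om A CA B CB →ₗ[R] Om A CA B CB) (α : List ((p : ℕ) × A p))
    (x : Big A CA) : (Big B CB ⊗[R] Big B CB) →ₗ[R] Om A CA B CB :=
  TensorProduct.lift ((LinearMap.mul R (Om A CA B CB)).compl₁₂
    ((TensorAlgebra.ι R) ∘ₗ (lT A CA B CB) ∘ₗ
      (TensorProduct.mk R (Big A CA) (Big B CB) x))
    (h ∘ₗ (LinearMap.mulRight R (wordA A CA B CB α)) ∘ₗ (TensorAlgebra.ι R) ∘ₗ lB A CA B CB))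

end TwoCoalgebras

section CobarValues

variable {R : Type} [CommRing R]
variable (A : ℕ → Type) [∀ n, AddCommGroup (A n)] [∀ n, Module R (A n)] (CA : CoalgStr R A)

/-- The linear part `[dx]` of the cobar differential of `Ω A` on a generator. -/
def linAA : ∀ p, A p →ₗ[R] OmA A CA
  | 0 => 0
  | p+1 => (TensorAlgebra.ι R).comp ((embT A CA p).comp (CA.d p))

/-- The quadratic part `∑ (-1)^{deg x₍₁₎} [x₍₁₎|x₍₂₎]` of the cobar differential of
`Ω A` on a generator. -/
def quadAA (p : ℕ) : A p →ₗ[R] OmA A CA :=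
  ∑ j : Fin (p+1), ((-1 : ℤ)^(j.1)) •
    ((mul2 (TensorAlgebra.ι R) (TensorAlgebra.ι R)).comp
      ((TensorProduct.map (embT A CA j.1) (embT A CA (p - j.1))).comp
        ((CA.comul j.1 (p - j.1)).comp (pcast (R := R) (A := A) (by have := j.is_le; omega)))))

/-- The value of the cobar differential of `Ω A` on the generator given by a homogeneous
element: `d_Ω [x] = -[dx] + ∑ (-1)^{deg x₍₁₎} [x₍₁₎|x₍₂₎]`. -/
def dvalAA (p : ℕ) : A p →ₗ[R] OmA A CA := - linAA A CA p + quadAA A CA p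

/-- The word of `Ω A` given by a list of homogeneous letters. -/
def wordAlg (l : List ((p : ℕ) × A p)) : OmA A CA :=
  (l.map fun t => TensorAlgebra.ι R (embT A CA t.1 t.2)).prod

end CobarValues

section CobarValuesT

variable {R : Type} [CommRing R]
variable (A : ℕ → Type) [∀ n, AddCommGroup (A n)] [∀ n, Module R (A n)] (CA : CoalgStr R A)
variable (B : ℕ → Type) [∀ n, AddCommGroup (B n)] [∀ n, Module R (B n)] (CB : CoalgStr R B)

/-- `[(da) b]` : the `A`-part of the linear term of the cobar differential of
`Ω (A ⊗ B)` on a generator of bidegree `(p,q)`. -/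
def linT1 : ∀ (p q : ℕ), (A p ⊗[R] B q) →ₗ[R] Om A CA B CB
  | 0, _ => 0
  | p+1, q => ((TensorAlgebra.ι R).comp (Γg A CA B CB p q)).comp
      (TensorProduct.map (CA.d p) LinearMap.id)

/-- `(-1)^p [a (db)]` : the `B`-part of the linear term. -/
def linT2 : ∀ (p q : ℕ), (A p ⊗[R] B q) →ₗ[R] Om A CA B CB
  | _, 0 => 0
  | p, q+1 => ((-1 : ℤ)^p) • (((TensorAlgebra.ι R).comp (Γg A CA B CB p q)).comp
      (TensorProduct.map LinearMap.id (CB.d q)))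

/-- The quadratic (Künneth) part of the cobar differential of `Ω (A ⊗ B)` on a
generator of bidegree `(p,q)`:
`∑ (-1)^{q₁p₂} (-1)^{p₁+q₁} [a₍₁₎b₍₁₎ | a₍₂₎b₍₂₎]` (primitive terms being killed by
the reduction embeddings). -/
def quadT (p q : ℕ) : (A p ⊗[R] B q) →ₗ[R] Om A CA B CB :=
  ∑ j : Fin (p+1), ∑ k : Fin (q+1),
    ((-1 : ℤ)^(k.1 * (p - j.1) + j.1 + k.1)) •
      ((mul2 ((TensorAlgebra.ι R).comp (Γg A CA B CB j.1 k.1))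
             ((TensorAlgebra.ι R).comp (Γg A CA B CB (p - j.1) (q - k.1)))).comp
        ((TensorProduct.tensorTensorTensorComm R (A j.1) (A (p - j.1)) (B k.1) (B (q - k.1))).toLinearMap.comp
          (TensorProduct.map
            ((CA.comul j.1 (p - j.1)).comp (pcast (R := R) (A := A) (by have := j.is_le; omega)))
            ((CB.comul k.1 (q - k.1)).comp (pcast (R := R) (A := B) (by have := k.is_le; omega))))))

/-- The value of the cobar differential of `Ω (A ⊗ B)` on the generator given by a
homogeneous element of `A_p ⊗ B_q`:
`d_Ω [w] = -[d_{A⊗B} w] + ∑ (-1)^{deg w₍₁₎} [w₍₁₎ | w₍₂₎]`. -/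
def dvalT (p q : ℕ) : (A p ⊗[R] B q) →ₗ[R] Om A CA B CB :=
  - linT1 A CA B CB p q - linT2 A CA B CB p q + quadT A CA B CB p q

end CobarValuesT

lemma mul2_tmul {R M N P : Type} [CommRing R] [AddCommGroup M] [Module R M] [AddCommGroup N]
    [Module R N] [Ring P] [Algebra R P] (f : M →ₗ[R] P) (g : N →ₗ[R] P) (m : M) (n : N) :
    mul2 f g (m ⊗ₜ[R] n) = f m * g n := rfl

lemma add_self_eq_zero_of_charP (R : Type) {M : Type} [CommRing R] [CharP R 2] [AddCommGroup M]
    [Module R M] (u : M) : u + u = 0 := by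
  rw [← two_smul R u, show (2 : R) = 0 by exact_mod_cast CharP.cast_eq_zero R 2, zero_smul]

/-- Coassociativity in terms of a representation of the diagonal. -/
lemma sum_coassoc {R W M : Type} [CommRing R] [AddCommGroup W] [Module R W] [AddCommGroup M]
    [Module R M] {Δ : W →ₗ[R] W ⊗[R] W} {y : W}
    (hy : TensorProduct.assoc R W W W (TensorProduct.map Δ LinearMap.id (Δ y))
      = TensorProduct.map LinearMap.id Δ (Δ y)) {S : Finset (W × W)}
    (hS : Δ y = ∑ i ∈ S, i.1 ⊗ₜ[R] i.2) (Φ : W ⊗[R] (W ⊗[R] W) →ₗ[R] M) :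
    ∑ i ∈ S, Φ (TensorProduct.assoc R W W W (Δ i.1 ⊗ₜ i.2))
      = ∑ i ∈ S, Φ (i.1 ⊗ₜ Δ i.2) := by
  have := congrArg Φ hy
  simpa [hS] using this

lemma mul2_assoc {R W O : Type} [CommRing R] [AddCommGroup W] [Module R W] [Ring O] [Algebra R O]
    (f g k : W →ₗ[R] O) (t : W ⊗[R] W) (y : W) :
    mul2 f (mul2 g k) (TensorProduct.assoc R W W W (t ⊗ₜ y)) = mul2 f g t * k y := by
  induction t with
  | zero => simp
  | add x y hx hy => simp only [map_add, TensorProduct.add_tmul, add_mul, hx, hy]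
  | tmul u u' => simp [mul2_tmul, mul_assoc]

lemma sum_coassoc_mul {R W O : Type} [CommRing R] [AddCommGroup W] [Module R W] [Ring O]
    [Algebra R O] {Δ : W →ₗ[R] W ⊗[R] W} {y : W}
    (hy : TensorProduct.assoc R W W W (TensorProduct.map Δ LinearMap.id (Δ y))
      = TensorProduct.map LinearMap.id Δ (Δ y)) {S : Finset (W × W)}
    (hS : Δ y = ∑ i ∈ S, i.1 ⊗ₜ[R] i.2) (f g k : W →ₗ[R] O) :
    ∑ i ∈ S, mul2 f g (Δ i.1) * k i.2 = ∑ i ∈ S, f i.1 * mul2 g k (Δ i.2) := by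
  have := sum_coassoc hy hS (mul2 f (mul2 g k))
  simpa only [mul2_assoc, mul2_tmul] using this

/-- The structure on the algebra `O = Ω (A ⊗ B)` (generated by the letters `[a]`, `[b]`, `[ab]`)
that makes the natural map `h` a homotopy from `sec ∘ q` to the identity in characteristic 2. -/
structure HomotopyData (R V W O Q : Type) [CommRing R] [AddCommGroup V] [Module R V]
    [AddCommGroup W] [Module R W] [Ring O] [Algebra R O] [Ring Q] [Algebra R Q] where
  gA : V →ₗ[R] O
  gB : W →ₗ[R] O
  gT : V ⊗[R] W →ₗ[R] O
  q : O →ₐ[R] Q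
  sec : Q →ₗ[R] O
  d : O →ₗ[R] O
  h : O →ₗ[R] O
  δA : V →ₗ[R] V
  ΔA : V →ₗ[R] V ⊗[R] V
  δB : W →ₗ[R] W
  ΔB : W →ₗ[R] W ⊗[R] W
  /-- The part of the differential of `[ab]` involving the reduced diagonal of `a`. -/
  crossA : V ⊗[R] V →ₗ[R] W →ₗ[R] O
  crossA_tmul : ∀ x x' y, crossA (x ⊗ₜ x') y = gT (x ⊗ₜ y) * gA x' + gA x * gT (x' ⊗ₜ y)
    + mul2 (gT ∘ₗ TensorProduct.mk R V W x) (gT ∘ₗ TensorProduct.mk R V W x') (ΔB y)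
  d_mul : ∀ u v, d (u * v) = d u * v + u * d v
  d_gA : ∀ x, d (gA x) = gA (δA x) + mul2 gA gA (ΔA x)
  d_gB : ∀ y, d (gB y) = gB (δB y) + mul2 gB gB (ΔB y)
  d_gT : ∀ x y, d (gT (x ⊗ₜ y)) = gT (δA x ⊗ₜ y) + gT (x ⊗ₜ δB y) + gA x * gB y + gB y * gA x
    + mul2 (gT ∘ₗ TensorProduct.mk R V W x) gB (ΔB y)
    + mul2 gB (gT ∘ₗ TensorProduct.mk R V W x) (ΔB y) + crossA (ΔA x) y
  coassoc : ∀ y, TensorProduct.assoc R W W W (TensorProduct.map ΔB LinearMap.id (ΔB y))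
    = TensorProduct.map LinearMap.id ΔB (ΔB y)
  coleib : ∀ y, ΔB (δB y) = TensorProduct.map δB LinearMap.id (ΔB y)
    + TensorProduct.map LinearMap.id δB (ΔB y)
  q_gT : ∀ t, q (gT t) = 0
  q_sec : ∀ z, q (sec z) = z
  q_comm : ∀ x y, q (gB y) * q (gA x) = q (gA x) * q (gB y)
  sec_one : sec 1 = 1
  sec_gA : ∀ x z, sec (q (gA x) * z) = gA x * sec z
  sec_gB : ∀ z y, sec (z * q (gB y)) = sec z * gB y
  ind : ∀ S : Submodule R O, 1 ∈ S → (∀ x, ∀ u ∈ S, gA x * u ∈ S) → (∀ y, ∀ u ∈ S, gB y * u ∈ S) →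
    (∀ x y, ∀ u ∈ S, gT (x ⊗ₜ y) * u ∈ S) → ∀ u, u ∈ S
  indQ : ∀ S : Submodule R Q, 1 ∈ S → (∀ x, ∀ z ∈ S, q (gA x) * z ∈ S) →
    (∀ y, ∀ z ∈ S, z * q (gB y) ∈ S) → ∀ z, z ∈ S
  h_sec : ∀ z, h (sec z) = 0
  h_gT_sec : ∀ w t z, h (w * gT t * sec z) = 0
  h_mul_gB_sec : ∀ w y z, h (w * (gB y * sec z)) = w * h (gB y * sec z) + h (w * sec (q (gB y) * z))
  h_gB_sec_gB : ∀ y z y', h (gB y * sec z * gB y') = h (gB y * sec z) * gB y'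
  h_gB_gA_sec : ∀ x y z, h (gB y * (gA x * sec z)) = gA x * h (gB y * sec z)
    + gT (x ⊗ₜ y) * sec z
    + mul2 (gT ∘ₗ TensorProduct.mk R V W x) (h ∘ₗ LinearMap.mulRight R (sec z) ∘ₗ gB) (ΔB y)

namespace HomotopyData

variable {R V W O Q : Type} [CommRing R] [AddCommGroup V] [Module R V]
    [AddCommGroup W] [Module R W] [Ring O] [Algebra R O] [Ring Q] [Algebra R Q]

lemma ext_induction (D : HomotopyData R V W O Q) {M : Type} [AddCommGroup M] [Module R M]
    (f g : O →ₗ[R] M) (h1 : f 1 = g 1)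
    (hA : ∀ x u, f u = g u → f (D.gA x * u) = g (D.gA x * u))
    (hB : ∀ y u, f u = g u → f (D.gB y * u) = g (D.gB y * u))
    (hT : ∀ x y u, f u = g u → f (D.gT (x ⊗ₜ y) * u) = g (D.gT (x ⊗ₜ y) * u)) (u : O) :
    f u = g u :=
  D.ind (LinearMap.eqLocus f g) h1 hA hB hT u

lemma ext_inductionQ (D : HomotopyData R V W O Q) {M : Type} [AddCommGroup M] [Module R M]
    (f g : Q →ₗ[R] M) (h1 : f 1 = g 1)
    (hA : ∀ x u, f u = g u → f (D.q (D.gA x) * u) = g (D.q (D.gA x) * u))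
    (hB : ∀ y u, f u = g u → f (u * D.q (D.gB y)) = g (u * D.q (D.gB y))) (u : Q) :
    f u = g u :=
  D.indQ (LinearMap.eqLocus f g) h1 hA hB u

section

variable (D : HomotopyData R V W O Q)

lemma d_one : D.d 1 = 0 := by
  have := D.d_mul 1 1
  simpa using this

lemma sec_mul2_gA (t : V ⊗[R] V) (z : Q) :
    D.sec (D.q (mul2 D.gA D.gA t) * z) = mul2 D.gA D.gA t * D.sec z := by
  induction t with
  | zero => simp
  | add x y hx hy => simp [add_mul, hx, hy]
  | tmul x x' => simp only [mul2_tmul, map_mul, mul_assoc, sec_gA]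

lemma sec_mul2_gB (t : W ⊗[R] W) (z : Q) :
    D.sec (z * D.q (mul2 D.gB D.gB t)) = D.sec z * mul2 D.gB D.gB t := by
  induction t with
  | zero => simp
  | add x y hx hy => simp [mul_add, hx, hy]
  | tmul x x' => simp only [mul2_tmul, map_mul, ← mul_assoc, sec_gB]

lemma sec_d_gA (x : V) (z : Q) :
    D.sec (D.q (D.d (D.gA x)) * z) = D.d (D.gA x) * D.sec z := by
  simp only [d_gA, map_add, add_mul, sec_gA, sec_mul2_gA]

lemma sec_d_gB (y : W) (z : Q) :
    D.sec (z * D.q (D.d (D.gB y))) = D.sec z * D.d (D.gB y) := by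
  simp only [d_gB, map_add, mul_add, sec_gB, sec_mul2_gB]

/-- `sec` is compatible with differentials. -/
lemma sec_q_d_sec (z : Q) : D.sec (D.q (D.d (D.sec z))) = D.d (D.sec z) := by
  refine D.ext_inductionQ (D.sec ∘ₗ D.q.toLinearMap ∘ₗ D.d ∘ₗ D.sec) (D.d ∘ₗ D.sec)
    ?_ ?_ ?_ z
  · simp [sec_one, d_one]
  · intro x u hu
    simp only [LinearMap.comp_apply, AlgHom.toLinearMap_apply] at hu ⊢
    simp only [sec_gA, d_mul, map_add, map_mul, sec_d_gA, hu, q_sec]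
  · intro x u hu
    simp only [LinearMap.comp_apply, AlgHom.toLinearMap_apply] at hu ⊢
    simp only [sec_gB, d_mul, map_add, map_mul, sec_d_gB, hu, q_sec]

/-- The recursion for `h` on a product, reducing the right factor to normal form. -/
lemma h_mul (w u : O) : D.h (w * u) = w * D.h u + D.h (w * D.sec (D.q u)) := by
  revert w
  have key : ∀ u, u ∈ (⨅ w : O, LinearMap.eqLocus (D.h ∘ₗ LinearMap.mulLeft R w)
      (LinearMap.mulLeft R w ∘ₗ D.h +
        D.h ∘ₗ LinearMap.mulLeft R w ∘ₗ D.sec ∘ₗ D.q.toLinearMap)) := by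
    refine D.ind _ ?_ ?_ ?_ ?_ <;>
      simp only [Submodule.mem_iInf, LinearMap.mem_eqLocus, LinearMap.comp_apply,
        LinearMap.add_apply, LinearMap.mulLeft_apply, AlgHom.toLinearMap_apply, map_mul]
    · intro w
      have := D.h_sec 1
      rw [sec_one] at this
      simp [sec_one, this]
    · intro x u hu w
      have h1 := hu (w * D.gA x)
      have h2 := hu (D.gA x)
      rw [← sec_gA, h_sec, add_zero] at h2
      rw [sec_gA, h2, ← mul_assoc, h1]
      simp only [mul_assoc]
    · intro y u hu w
      have h1 := hu (w * D.gB y)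
      have h2 := hu (D.gB y)
      have h3 := D.h_mul_gB_sec w y (D.q u)
      rw [h2, ← mul_assoc, h1, mul_assoc w _ (D.sec _), h3, mul_add, mul_assoc, add_assoc]
    · intro x y u hu w
      have h1 := hu (w * D.gT (x ⊗ₜ y))
      have h2 := hu (D.gT (x ⊗ₜ y))
      have h3 := D.h_gT_sec 1 (x ⊗ₜ y) (D.q u)
      have h4 := D.h_gT_sec w (x ⊗ₜ y) (D.q u)
      rw [one_mul] at h3
      rw [h2, h3, ← mul_assoc, h1, h4]
      simp [q_gT, mul_assoc]
  simpa [Submodule.mem_iInf] using key u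

lemma h_gA_mul (x : V) (u : O) : D.h (D.gA x * u) = D.gA x * D.h u := by
  rw [h_mul, ← sec_gA, h_sec, add_zero]

lemma h_gT_mul (t : V ⊗[R] W) (u : O) : D.h (D.gT t * u) = D.gT t * D.h u := by
  have := D.h_gT_sec 1 t (D.q u)
  rw [one_mul] at this
  rw [h_mul, this, add_zero]

lemma h_gB_mul (y : W) (u : O) :
    D.h (D.gB y * u) = D.gB y * D.h u + D.h (D.gB y * D.sec (D.q u)) := D.h_mul _ _

lemma h_mul_gB (u : O) (y : W) : D.h (u * D.gB y) = D.h u * D.gB y := by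
  refine D.ext_induction (D.h ∘ₗ LinearMap.mulRight R (D.gB y))
    (LinearMap.mulRight R (D.gB y) ∘ₗ D.h) ?_ ?_ ?_ ?_ u <;>
      simp only [LinearMap.comp_apply, LinearMap.mulRight_apply]
  · have h1 := D.h_sec 1
    have h2 := D.h_sec (1 * D.q (D.gB y))
    rw [sec_gB] at h2
    rw [sec_one] at h1 h2
    rw [h1, h2, zero_mul]
  · intro x u hu
    rw [mul_assoc, h_gA_mul, h_gA_mul, hu, mul_assoc]
  · intro x u hu
    rw [mul_assoc, h_gB_mul, hu, map_mul D.q, sec_gB, ← mul_assoc _ (D.sec _),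
      h_gB_sec_gB, D.h_gB_mul x u, add_mul, mul_assoc]
  · intro x x' u hu
    rw [mul_assoc, h_gT_mul, h_gT_mul, hu, mul_assoc]

lemma q_gB_comm_mul2 (y : W) (t : V ⊗[R] V) :
    D.q (D.gB y) * D.q (mul2 D.gA D.gA t) = D.q (mul2 D.gA D.gA t) * D.q (D.gB y) := by
  induction t with
  | zero => simp
  | add x y hx hy => simp only [map_add, mul_add, add_mul, hx, hy]
  | tmul x x' => rw [mul2_tmul, map_mul, ← mul_assoc, q_comm, mul_assoc, q_comm, mul_assoc]

lemma q_mul2_comm_gA (x : V) (t : W ⊗[R] W) :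
    D.q (mul2 D.gB D.gB t) * D.q (D.gA x) = D.q (D.gA x) * D.q (mul2 D.gB D.gB t) := by
  induction t with
  | zero => simp
  | add x y hx hy => simp only [map_add, mul_add, add_mul, hx, hy]
  | tmul y y' => rw [mul2_tmul, map_mul, mul_assoc, q_comm, ← mul_assoc, q_comm, mul_assoc]

lemma q_gB_comm_d_gA (y : W) (x : V) :
    D.q (D.gB y) * D.q (D.d (D.gA x)) = D.q (D.d (D.gA x)) * D.q (D.gB y) := by
  simp only [d_gA, map_add, mul_add, add_mul, q_comm, q_gB_comm_mul2]

lemma q_d_gB_comm_gA (y : W) (x : V) :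
    D.q (D.d (D.gB y)) * D.q (D.gA x) = D.q (D.gA x) * D.q (D.d (D.gB y)) := by
  simp only [d_gB, map_add, mul_add, add_mul, q_comm, q_mul2_comm_gA]

/-- The letter `[x y]` as a function of `y`. -/
def letterT (x : V) : W →ₗ[R] O := D.gT ∘ₗ TensorProduct.mk R V W x

lemma letterT_apply (x : V) (y : W) : D.letterT x y = D.gT (x ⊗ₜ y) := rfl

lemma sec_gB_one (y : W) : D.sec (D.q (D.gB y)) = D.gB y := by
  rw [← one_mul (D.q (D.gB y)), sec_gB, sec_one, one_mul]

lemma q_d_sec_gB_mul (y : W) (z : Q) :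
    D.q (D.d (D.sec (D.q (D.gB y) * z)))
      = D.q (D.d (D.gB y)) * z + D.q (D.gB y) * D.q (D.d (D.sec z)) := by
  refine D.ext_inductionQ
    (D.q.toLinearMap ∘ₗ D.d ∘ₗ D.sec ∘ₗ LinearMap.mulLeft R (D.q (D.gB y)))
    (LinearMap.mulLeft R (D.q (D.d (D.gB y))) + LinearMap.mulLeft R (D.q (D.gB y)) ∘ₗ
      D.q.toLinearMap ∘ₗ D.d ∘ₗ D.sec) ?_ ?_ ?_ z <;>
    simp only [LinearMap.comp_apply, LinearMap.add_apply, LinearMap.mulLeft_apply,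
      AlgHom.toLinearMap_apply]
  · simp [sec_gB_one, sec_one, d_one]
  · intro x u hu
    have a1 := congrArg (· * u) (D.q_gB_comm_d_gA y x)
    have a2 := congrArg (· * u) (D.q_d_gB_comm_gA y x)
    have a3 := congrArg (· * D.q (D.d (D.sec u))) (D.q_comm x y)
    simp only [mul_assoc] at a1 a2 a3
    rw [← mul_assoc (D.q (D.gB y)), q_comm, mul_assoc, sec_gA, d_mul, map_add, map_mul D.q,
      map_mul D.q, q_sec, hu, sec_gA, d_mul, map_add, map_mul D.q, map_mul D.q, q_sec, mul_add,
      mul_add, a1, a2, a3]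
    abel
  · intro y' u hu
    rw [← mul_assoc, sec_gB, d_mul, map_add, map_mul D.q, map_mul D.q, q_sec, hu, sec_gB, d_mul, map_add,
      map_mul D.q, map_mul D.q, q_sec]
    simp only [mul_assoc, add_mul, mul_add]
    abel

lemma q_mul2_letterT_left (x : V) (f : W →ₗ[R] O) (t : W ⊗[R] W) :
    D.q (mul2 (D.letterT x) f t) = 0 := by
  induction t with
  | zero => simp
  | add x y hx hy => simp only [map_add, hx, hy, add_zero]
  | tmul y y' => rw [mul2_tmul, map_mul, letterT_apply, q_gT, zero_mul]

lemma q_mul2_letterT_right (x : V) (f : W →ₗ[R] O) (t : W ⊗[R] W) :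
    D.q (mul2 f (D.letterT x) t) = 0 := by
  induction t with
  | zero => simp
  | add x y hx hy => simp only [map_add, hx, hy, add_zero]
  | tmul y y' => rw [mul2_tmul, map_mul, letterT_apply, q_gT, mul_zero]

lemma crossA_tmul' (x x' : V) (y : W) : D.crossA (x ⊗ₜ x') y = D.letterT x y * D.gA x'
    + D.gA x * D.letterT x' y + mul2 (D.letterT x) (D.letterT x') (D.ΔB y) :=
  D.crossA_tmul x x' y

lemma q_crossA (t : V ⊗[R] V) (y : W) : D.q (D.crossA t y) = 0 := by
  induction t with
  | zero => simp
  | add x y hx hy => simp only [map_add, LinearMap.add_apply, hx, hy, add_zero]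
  | tmul x x' =>
    simp [crossA_tmul', q_mul2_letterT_left, letterT_apply, q_gT]

lemma d_gT' (x : V) (y : W) : D.d (D.gT (x ⊗ₜ y)) = D.letterT (D.δA x) y + D.letterT x (D.δB y)
    + D.gA x * D.gB y + D.gB y * D.gA x + mul2 (D.letterT x) D.gB (D.ΔB y)
    + mul2 D.gB (D.letterT x) (D.ΔB y) + D.crossA (D.ΔA x) y :=
  D.d_gT x y

section CharTwo

variable [CharP R 2]

lemma q_d_gT (x : V) (y : W) : D.q (D.d (D.gT (x ⊗ₜ y))) = 0 := by
  simp [d_gT', letterT_apply, q_gT, q_mul2_letterT_left, q_mul2_letterT_right, q_crossA, q_comm,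
    add_self_eq_zero_of_charP R]

/-- `q` is compatible with differentials. -/
lemma q_d_sec_q (v : O) : D.q (D.d (D.sec (D.q v))) = D.q (D.d v) := by
  refine D.ext_induction (D.q.toLinearMap ∘ₗ D.d ∘ₗ D.sec ∘ₗ D.q.toLinearMap)
    (D.q.toLinearMap ∘ₗ D.d) ?_ ?_ ?_ ?_ v <;>
    simp only [LinearMap.comp_apply, AlgHom.toLinearMap_apply]
  · simp [sec_one]
  · intro x u hu
    rw [map_mul, sec_gA, d_mul, d_mul, map_add, map_add, map_mul, map_mul, map_mul, map_mul, hu,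
      q_sec]
  · intro y u hu
    rw [map_mul, q_d_sec_gB_mul, d_mul, map_add, map_mul, map_mul, hu]
  · intro x y u hu
    rw [d_mul]
    simp [q_gT, q_d_gT]

lemma sec_q_d (v : O) : D.sec (D.q (D.d v)) = D.d (D.sec (D.q v)) := by
  rw [← q_d_sec_q, sec_q_d_sec]

end CharTwo

/-- The map `y ↦ h [y|z]` for `z` in normal form. -/
def H (z : Q) : W →ₗ[R] O := D.h ∘ₗ LinearMap.mulRight R (D.sec z) ∘ₗ D.gB

lemma H_apply (z : Q) (y : W) : D.H z y = D.h (D.gB y * D.sec z) := rfl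

/-- The map `y ⊗ y' ↦ h [y|σ q [y'|z]]` for `z` in normal form. -/
def J (z : Q) : W ⊗[R] W →ₗ[R] O :=
  D.h ∘ₗ mul2 D.gB (D.sec ∘ₗ LinearMap.mulRight R z ∘ₗ D.q.toLinearMap ∘ₗ D.gB)

lemma J_tmul (z : Q) (y y' : W) : D.J z (y ⊗ₜ y') = D.H (D.q (D.gB y') * z) y := rfl

lemma h_gB_gA (x : V) (y : W) (z : Q) : D.h (D.gB y * (D.gA x * D.sec z))
    = D.gA x * D.H z y + D.letterT x y * D.sec z + mul2 (D.letterT x) (D.H z) (D.ΔB y) :=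
  D.h_gB_gA_sec x y z

lemma h_gB_gB (y y' : W) (z : Q) : D.h (D.gB y * (D.gB y' * D.sec z))
    = D.gB y * D.H z y' + D.J z (y ⊗ₜ y') := by
  rw [h_gB_mul, map_mul D.q, q_sec]; rfl

lemma h_mul2_gB (t : W ⊗[R] W) (z : Q) : D.h (mul2 D.gB D.gB t * D.sec z)
    = mul2 D.gB (D.H z) t + D.J z t := by
  induction t with
  | zero => simp
  | add x y hx hy => simp only [map_add, add_mul, hx, hy]; abel
  | tmul y y' => rw [mul2_tmul, mul_assoc, h_gB_gB, mul2_tmul]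

lemma h_gB_gB_gA (x : V) (y y' : W) (z : Q) : D.h (D.gB y * (D.gB y' * (D.gA x * D.sec z)))
    = D.gB y * (D.gA x * D.H z y' + D.letterT x y' * D.sec z
        + mul2 (D.letterT x) (D.H z) (D.ΔB y'))
      + (D.gA x * D.J z (y ⊗ₜ y') + D.letterT x y * D.sec (D.q (D.gB y') * z)
        + mul2 (D.letterT x) (D.H (D.q (D.gB y') * z)) (D.ΔB y)) := by
  rw [h_gB_mul, map_mul D.q, map_mul D.q, q_sec, ← mul_assoc (D.q (D.gB y')), q_comm, mul_assoc, sec_gA, h_gB_gA, h_gB_gA,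
    J_tmul]

lemma sum_coassoc_mul {y : W} {S : Finset (W × W)} (hS : D.ΔB y = ∑ i ∈ S, i.1 ⊗ₜ[R] i.2)
    (f g k : W →ₗ[R] O) : ∑ i ∈ S, mul2 f g (D.ΔB i.1) * k i.2
      = ∑ i ∈ S, f i.1 * mul2 g k (D.ΔB i.2) :=
  CJ2.sum_coassoc_mul (D.coassoc y) hS f g k

lemma mul2_J_assoc (f : W →ₗ[R] O) (z : Q) (t : W ⊗[R] W) (y : W) :
    mul2 f (D.J z) (TensorProduct.assoc R W W W (t ⊗ₜ y)) = mul2 f (D.H (D.q (D.gB y) * z)) t := by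
  induction t with
  | zero => simp
  | add x y hx hy => simp only [map_add, TensorProduct.add_tmul, hx, hy]
  | tmul u u' => simp [mul2_tmul, J_tmul]

lemma sum_coassoc_J {y : W} {S : Finset (W × W)} (hS : D.ΔB y = ∑ i ∈ S, i.1 ⊗ₜ[R] i.2)
    (f : W →ₗ[R] O) (z : Q) : ∑ i ∈ S, mul2 f (D.H (D.q (D.gB i.2) * z)) (D.ΔB i.1)
      = ∑ i ∈ S, f i.1 * D.J z (D.ΔB i.2) := by
  have := sum_coassoc (D.coassoc y) hS (mul2 f (D.J z))
  simpa only [mul2_J_assoc, mul2_tmul] using this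

lemma h_gB_mul2_gA {y : W} {S : Finset (W × W)} (hS : D.ΔB y = ∑ i ∈ S, i.1 ⊗ₜ[R] i.2)
    (t : V ⊗[R] V) (z : Q) : D.h (D.gB y * (mul2 D.gA D.gA t * D.sec z))
      = mul2 D.gA D.gA t * D.H z y + D.crossA t y * D.sec z
        + ∑ i ∈ S, D.crossA t i.1 * D.H z i.2 := by
  induction t with
  | zero => simp
  | add t t' ht ht' =>
    simp only [map_add, add_mul, mul_add, ht, ht', LinearMap.add_apply, Finset.sum_add_distrib]
    abel
  | tmul x x' =>
    have h1 : ∀ y, D.H (D.q (D.gA x') * z) y = D.gA x' * D.H z y + D.letterT x' y * D.sec z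
        + mul2 (D.letterT x') (D.H z) (D.ΔB y) := fun y ↦ by
      rw [H_apply, sec_gA, h_gB_gA]
    have h2 := D.sum_coassoc_mul hS (D.letterT x) (D.letterT x') (D.H z)
    rw [mul2_tmul, mul_assoc, ← sec_gA, h_gB_gA, h1, sec_gA]
    nth_rewrite 2 [hS]
    simp only [map_sum, mul2_tmul, h1, crossA_tmul', add_mul, mul_add, Finset.sum_add_distrib, h2]
    rw [hS]
    simp only [map_sum, mul2_tmul, mul_assoc, Finset.sum_mul, Finset.mul_sum]
    abel

lemma h_letterT_mul (x : V) (y : W) (u : O) :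
    D.h (D.letterT x y * u) = D.letterT x y * D.h u := D.h_gT_mul _ u

lemma h_mul2_letterT (x : V) (f : W →ₗ[R] O) (t : W ⊗[R] W) (u : O) (k : W →ₗ[R] O)
    (hk : ∀ y, D.h (f y * u) = k y) :
    D.h (mul2 (D.letterT x) f t * u) = mul2 (D.letterT x) k t := by
  induction t with
  | zero => simp
  | add t t' ht ht' => simp only [map_add, add_mul, ht, ht']
  | tmul y y' => rw [mul2_tmul, mul2_tmul, mul_assoc, h_letterT_mul, hk]

lemma h_mul2_gB_letterT (x : V) (t : W ⊗[R] W) (z : Q) :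
    D.h (mul2 D.gB (D.letterT x) t * D.sec z) = 0 := by
  induction t with
  | zero => simp
  | add t t' ht ht' => simp only [map_add, add_mul, ht, ht', add_zero]
  | tmul y y' => exact D.h_gT_sec (D.gB y) _ z

lemma h_crossA_sec (t : V ⊗[R] V) (y : W) (z : Q) : D.h (D.crossA t y * D.sec z) = 0 := by
  induction t with
  | zero => simp
  | add t t' ht ht' => simp only [map_add, LinearMap.add_apply, add_mul, ht, ht', add_zero]
  | tmul x x' =>
    rw [crossA_tmul', add_mul, add_mul, map_add, map_add,
      D.h_mul2_letterT x (D.letterT x') _ _ 0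
        (fun y ↦ by rw [h_letterT_mul, h_sec, mul_zero]; rfl),
      mul_assoc, mul_assoc, h_letterT_mul, h_gA_mul, h_gA_mul, h_letterT_mul, h_sec]
    have : ∀ t : W ⊗[R] W, mul2 (D.letterT x) (0 : W →ₗ[R] O) t = 0 := fun t ↦ by
      induction t with
      | zero => simp
      | add t t' ht ht' => rw [map_add, ht, ht', add_zero]
      | tmul y y' => simp [mul2_tmul]
    simp [this]

section CharTwo

variable [CharP R 2]

/-- The homotopy identity for `[y|x|z]`, given the one for all `[y|z]`, `z` in normal form. -/
lemma homotopy_gB_gA_sec (x : V) (z : Q)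
    (hz : ∀ y, D.d (D.h (D.gB y * D.sec z)) + D.h (D.d (D.gB y * D.sec z))
      = D.sec (D.q (D.gB y * D.sec z)) + D.gB y * D.sec z) (y : W) :
    D.d (D.h (D.gB y * (D.gA x * D.sec z))) + D.h (D.d (D.gB y * (D.gA x * D.sec z)))
      = D.sec (D.q (D.gB y * (D.gA x * D.sec z))) + D.gB y * (D.gA x * D.sec z) := by
  have two := add_self_eq_zero_of_charP R (M := O)
  obtain ⟨S, hS⟩ := TensorProduct.exists_finset (D.ΔB y)
  obtain ⟨z', hz'⟩ : ∃ z', D.d (D.sec z) = D.sec z' := ⟨_, (D.sec_q_d_sec z).symm⟩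
  have dH : ∀ y, D.d (D.H z y) = D.H z (D.δB y) + mul2 D.gB (D.H z) (D.ΔB y) + D.J z (D.ΔB y)
      + D.H z' y + D.sec (D.q (D.gB y) * z) + D.gB y * D.sec z := fun y ↦ by
    have h1 := hz y
    rw [d_mul, d_gB, hz', add_mul, map_add, map_add, h_mul2_gB, map_mul D.q, q_sec, ← H_apply,
      ← H_apply, ← H_apply] at h1
    rw [add_assoc, ← h1]
    have h2 : (2 : O) = 0 := by rw [← one_add_one_eq_two, two]
    abel_nf
    simp [h2]
  have c1 := D.sum_coassoc_mul hS D.gB (D.letterT x) (D.H z)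
  have c2 := D.sum_coassoc_mul hS (D.letterT x) D.gB (D.H z)
  have c3 := D.sum_coassoc_J hS (D.letterT x) z
  have e1 : ∀ u z, D.h (D.gB y * (D.gA u * D.sec z)) = D.gA u * D.H z y + D.letterT u y * D.sec z
      + ∑ i ∈ S, D.letterT u i.1 * D.H z i.2 := fun u z ↦ by
    rw [h_gB_gA, hS]; simp only [map_sum, mul2_tmul]
  have e2 : D.h (D.gB (D.δB y) * (D.gA x * D.sec z)) = D.gA x * D.H z (D.δB y)
      + D.letterT x (D.δB y) * D.sec z + ∑ i ∈ S, D.letterT x (D.δB i.1) * D.H z i.2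
      + ∑ i ∈ S, D.letterT x i.1 * D.H z (D.δB i.2) := by
    rw [h_gB_gA, coleib, hS]
    simp only [map_sum, mul2_tmul, map_add, TensorProduct.map_tmul, LinearMap.id_apply, add_assoc]
  have e3 : D.h (mul2 D.gB D.gB (D.ΔB y) * (D.gA x * D.sec z))
      = ∑ i ∈ S, D.gB i.1 * (D.gA x * D.H z i.2) + ∑ i ∈ S, D.gB i.1 * D.letterT x i.2 * D.sec z
        + ∑ i ∈ S, D.gB i.1 * mul2 (D.letterT x) (D.H z) (D.ΔB i.2)
        + D.gA x * D.J z (D.ΔB y) + ∑ i ∈ S, D.letterT x i.1 * D.sec (D.q (D.gB i.2) * z)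
        + ∑ i ∈ S, D.letterT x i.1 * D.J z (D.ΔB i.2) := by
    rw [← c3]
    nth_rewrite 1 2 [hS]
    simp only [map_sum, mul2_tmul, Finset.sum_mul, mul_assoc, h_gB_gB_gA, mul_add,
      Finset.sum_add_distrib, Finset.mul_sum]
    abel
  have e4 := D.h_gB_mul2_gA hS (D.ΔA x) z
  have t1 : mul2 (D.letterT x) D.gB (D.ΔB y) = ∑ i ∈ S, D.letterT x i.1 * D.gB i.2 := by
    rw [hS]; simp only [map_sum, mul2_tmul]
  have t2 : mul2 D.gB (D.letterT x) (D.ΔB y) = ∑ i ∈ S, D.gB i.1 * D.letterT x i.2 := by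
    rw [hS]; simp only [map_sum, mul2_tmul]
  have t3 : mul2 D.gB (D.H z) (D.ΔB y) = ∑ i ∈ S, D.gB i.1 * D.H z i.2 := by
    rw [hS]; simp only [map_sum, mul2_tmul]
  have dT : ∀ y, D.d (D.letterT x y) = D.letterT (D.δA x) y + D.letterT x (D.δB y)
    + D.gA x * D.gB y + D.gB y * D.gA x + mul2 (D.letterT x) D.gB (D.ΔB y)
    + mul2 D.gB (D.letterT x) (D.ΔB y) + D.crossA (D.ΔA x) y := D.d_gT' x
  have hq : D.sec (D.q (D.gB y * (D.gA x * D.sec z))) = D.gA x * D.sec (D.q (D.gB y) * z) := by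
    rw [map_mul D.q, map_mul D.q, q_sec, ← mul_assoc, q_comm, mul_assoc, sec_gA]
  have hd : D.h (D.d (D.gB y * (D.gA x * D.sec z))) = D.h (D.gB (D.δB y) * (D.gA x * D.sec z))
      + D.h (mul2 D.gB D.gB (D.ΔB y) * (D.gA x * D.sec z))
      + (D.h (D.gB y * (D.gA (D.δA x) * D.sec z))
        + D.h (D.gB y * (mul2 D.gA D.gA (D.ΔA x) * D.sec z))
        + D.h (D.gB y * (D.gA x * D.sec z'))) := by
    rw [d_mul, d_mul, d_gB, d_gA, hz']
    simp only [map_add, add_mul, mul_add]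
  rw [hq, hd, e2, e3, e4, e1, e1, e1]
  simp only [map_add, d_mul, map_sum, dT, dH, d_gA, hz', add_mul, mul_add,
    Finset.sum_add_distrib, c1, c2, t1, t2, t3, Finset.sum_mul, Finset.mul_sum, mul_assoc]
  abel_nf
  simp only [two_zsmul, two, zero_add, add_zero]

lemma homotopy_mul_gB (u : O) (y : W)
    (hu : D.d (D.h u) + D.h (D.d u) = D.sec (D.q u) + u) :
    D.d (D.h (u * D.gB y)) + D.h (D.d (u * D.gB y))
      = D.sec (D.q (u * D.gB y)) + u * D.gB y := by
  have two := add_self_eq_zero_of_charP R (M := O)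
  have h1 : ∀ t : W ⊗[R] W, D.h (u * mul2 D.gB D.gB t) = D.h u * mul2 D.gB D.gB t := fun t ↦ by
    induction t with
    | zero => simp
    | add x y hx hy => simp only [map_add, mul_add, hx, hy]
    | tmul x x' => rw [mul2_tmul, ← mul_assoc, h_mul_gB, h_mul_gB, mul_assoc]
  have h2 : D.h (u * D.d (D.gB y)) = D.h u * D.d (D.gB y) := by
    simp only [d_gB, mul_add, map_add, h_mul_gB, h1]
  rw [h_mul_gB, d_mul, d_mul, map_add, h_mul_gB, h2, map_mul, sec_gB, ← add_mul, ← hu]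
  generalize D.h u * D.d (D.gB y) = a
  rw [add_mul]
  have : ∀ b c : O, b + a + (c + a) = b + c := fun b c ↦ by
    rw [add_add_add_comm, two, add_zero]
  rw [this]

lemma homotopy_gB_sec (z : Q) (y : W) :
    D.d (D.h (D.gB y * D.sec z)) + D.h (D.d (D.gB y * D.sec z))
      = D.sec (D.q (D.gB y * D.sec z)) + D.gB y * D.sec z := by
  have two := add_self_eq_zero_of_charP R (M := O)
  revert y
  have key : ∀ z, z ∈ (⨅ y : W, LinearMap.eqLocus
      ((D.d ∘ₗ D.h + D.h ∘ₗ D.d) ∘ₗ LinearMap.mulLeft R (D.gB y) ∘ₗ D.sec)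
      ((D.sec ∘ₗ D.q.toLinearMap + LinearMap.id) ∘ₗ LinearMap.mulLeft R (D.gB y) ∘ₗ D.sec)) := by
    refine D.indQ _ ?_ ?_ ?_ <;>
      simp only [Submodule.mem_iInf, LinearMap.mem_eqLocus, LinearMap.comp_apply,
        LinearMap.add_apply, LinearMap.mulLeft_apply, AlgHom.toLinearMap_apply, LinearMap.id_apply]
    · intro y
      have h1 : D.h (D.gB y) = 0 := by rw [← sec_gB_one, h_sec]
      have h2 := D.h_sec (1 * D.q (D.d (D.gB y)))
      rw [sec_d_gB, sec_one, one_mul] at h2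
      rw [sec_one, mul_one, h1, h2, sec_gB_one, two, map_zero, add_zero]
    · intro x z hz y
      rw [sec_gA]
      exact D.homotopy_gB_gA_sec x z hz y
    · intro y' z hz y
      rw [sec_gB, ← mul_assoc]
      exact D.homotopy_mul_gB _ y' (hz y)
  simpa [Submodule.mem_iInf] using key z

lemma h_d_gT_sec (x : V) (y : W) (z : Q) :
    D.h (D.d (D.gT (x ⊗ₜ y)) * D.sec z) = D.gT (x ⊗ₜ y) * D.sec z := by
  have two := add_self_eq_zero_of_charP R (M := O)
  have h2 : (2 : O) = 0 := by rw [← one_add_one_eq_two, two]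
  simp only [d_gT', add_mul, map_add, h_letterT_mul, h_sec, mul_assoc, h_gA_mul, h_gB_gA,
    h_crossA_sec, h_mul2_gB_letterT, ← H_apply,
    D.h_mul2_letterT x D.gB _ (D.sec z) (D.H z) (fun y ↦ rfl)]
  rw [← letterT_apply]
  abel_nf
  simp [h2]

/-- `h` is a homotopy from `sec ∘ q` to the identity. -/
theorem homotopy (w : O) : D.d (D.h w) + D.h (D.d w) = D.sec (D.q w) + w := by
  have two := add_self_eq_zero_of_charP R (M := O)
  refine D.ext_induction (D.d ∘ₗ D.h + D.h ∘ₗ D.d) (D.sec ∘ₗ D.q.toLinearMap + LinearMap.id)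
    ?_ ?_ ?_ ?_ w <;>
    simp only [LinearMap.comp_apply, LinearMap.add_apply, AlgHom.toLinearMap_apply,
      LinearMap.id_apply]
  · have h1 := D.h_sec 1
    rw [sec_one] at h1
    simp [d_one, sec_one, two, h1]
  · intro x u hu
    have h1 : D.h (D.d (D.gA x) * u) = D.d (D.gA x) * D.h u := by
      rw [h_mul, ← sec_d_gA, h_sec, add_zero]
    rw [h_gA_mul, d_mul, d_mul, map_add, h1, h_gA_mul, map_mul, sec_gA, ← mul_add, ← hu, mul_add,
      add_add_add_comm, two, zero_add]
  · intro y u hu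
    have h1 := D.homotopy_gB_sec (D.q u) y
    rw [d_mul, map_add, ← sec_q_d, map_mul D.q, q_sec, ← map_mul D.q] at h1
    rw [h_mul, d_mul, map_add, map_add, d_mul, D.h_mul (D.d (D.gB y)) u,
      D.h_mul (D.gB y) (D.d u)]
    calc _ = D.gB y * (D.d (D.h u) + D.h (D.d u)) + (D.d (D.h (D.gB y * D.sec (D.q u)))
          + (D.h (D.d (D.gB y) * D.sec (D.q u)) + D.h (D.gB y * D.sec (D.q (D.d u)))))
          + (D.d (D.gB y) * D.h u + D.d (D.gB y) * D.h u) := by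
          rw [mul_add]; abel
      _ = (D.gB y * D.sec (D.q u) + D.gB y * D.sec (D.q u)) + (D.sec (D.q (D.gB y * u))
          + D.gB y * u) := by
          rw [h1, hu, two, mul_add]; abel
      _ = _ := by rw [two, zero_add]
  · intro x y u hu
    rw [h_gT_mul, d_mul, d_mul, map_add, h_gT_mul, D.h_mul (D.d _), h_d_gT_sec]
    calc _ = D.gT (x ⊗ₜ y) * (D.d (D.h u) + D.h (D.d u)) + D.gT (x ⊗ₜ y) * D.sec (D.q u)
          + (D.d (D.gT (x ⊗ₜ y)) * D.h u + D.d (D.gT (x ⊗ₜ y)) * D.h u) := by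
          rw [mul_add]; abel
      _ = D.gT (x ⊗ₜ y) * u
          + (D.gT (x ⊗ₜ y) * D.sec (D.q u) + D.gT (x ⊗ₜ y) * D.sec (D.q u)) := by
          rw [hu, two, mul_add]; abel
      _ = _ := by rw [two, map_mul, q_gT, zero_mul, map_zero, zero_add, add_zero]

end CharTwo

end

end HomotopyData

section Coalgebra

variable {R : Type} [CommRing R]
variable (A : ℕ → Type) [∀ n, AddCommGroup (A n)] [∀ n, Module R (A n)] (CA : CoalgStr R A)

/-- The inclusion of `Ā` into `A` in degree `n`. -/
def sect : ∀ n, redT A CA n →ₗ[R] A n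
  | 0 => (LinearMap.ker CA.counit).subtype
  | _+1 => LinearMap.id

lemma epsAt_sect (n : ℕ) (x : redT A CA n) : epsAt A CA n (sect A CA n x) = 0 := by
  cases n with
  | zero => exact x.2
  | succ n => rfl

lemma toRed_sect (n : ℕ) (x : redT A CA n) : toRed A CA n (sect A CA n x) = x := by
  cases n with
  | zero =>
    have hx : CA.counit x.1 = 0 := x.2
    refine Subtype.ext ?_
    change x.1 - CA.coaug (CA.counit x.1) = x.1
    rw [hx, map_zero, sub_zero]
  | succ n => rfl

lemma coaug_eq_smul (r : R) : CA.coaug r = r • CA.coaug 1 := by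
  rw [← map_smul, smul_eq_mul, mul_one]

lemma toRed_coaug (r : R) : toRed A CA 0 (CA.coaug r) = 0 := by
  refine Subtype.ext ?_
  change CA.coaug r - CA.coaug (CA.counit (CA.coaug r)) = 0
  rw [coaug_eq_smul A CA r, map_smul, CA.counit_coaug, smul_eq_mul, mul_one, ← coaug_eq_smul,
    sub_self]

lemma embT_coaug (r : R) : embT A CA 0 (CA.coaug r) = 0 := by
  simp [embT, toRed_coaug]

lemma sect_toRed_zero (a : A 0) :
    sect A CA 0 (toRed A CA 0 a) = a - CA.coaug (CA.counit a) := rfl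

lemma embT_sect (n : ℕ) (x : redT A CA n) :
    embT A CA n (sect A CA n x) = DirectSum.lof R ℕ (redT A CA) n x := by
  simp [embT, toRed_sect]

lemma big_induction {P : Big A CA → Prop} (x : Big A CA)
    (hadd : ∀ x y, P x → P y → P (x + y)) (hz : P 0)
    (hemb : ∀ n a, epsAt A CA n a = 0 → P (embT A CA n a)) : P x := by
  induction x using DirectSum.induction_on with
  | zero => exact hz
  | add x y hx hy => exact hadd x y hx hy
  | of n x =>
    have := hemb n _ (epsAt_sect A CA n x)
    rwa [embT_sect] at this

/-- The differential of `A` composed with the projection to `Ā`. -/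
def dRed : ∀ n, A n →ₗ[R] Big A CA
  | 0 => 0
  | n+1 => embT A CA n ∘ₗ CA.d n

/-- The differential of `Ā`. -/
def bigD : Big A CA →ₗ[R] Big A CA :=
  DirectSum.toModule R ℕ _ fun n => dRed A CA n ∘ₗ sect A CA n

/-- The reduced diagonal of `Ā`. -/
def bigΔ : Big A CA →ₗ[R] Big A CA ⊗[R] Big A CA :=
  DirectSum.toModule R ℕ _ fun n => bigDiag A CA n ∘ₗ sect A CA n

/-- The component of the comultiplication in `A s ⊗ A r` (zero unless `p = s + r`). -/
def comulAt (p s r : ℕ) : A p →ₗ[R] A s ⊗[R] A r :=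
  if h : p = s + r then CA.comul s r ∘ₗ pcast (R := R) (A := A) h else 0

lemma comulAt_add (s r : ℕ) : comulAt A CA (s + r) s r = CA.comul s r := by
  rw [comulAt, dif_pos rfl]
  rfl

lemma comulAt_of_eq {p s r : ℕ} (h : p = s + r) :
    comulAt A CA p s r = CA.comul s r ∘ₗ pcast (R := R) (A := A) h := dif_pos h

lemma bigDiag_apply (p : ℕ) (a : A p) :
    bigDiag A CA p a = ∑ ij ∈ Finset.HasAntidiagonal.antidiagonal p,
      TensorProduct.map (embT A CA ij.1) (embT A CA ij.2) (comulAt A CA p ij.1 ij.2 a) := by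
  rw [Finset.Nat.sum_antidiagonal_eq_sum_range_succ (fun i j =>
    TensorProduct.map (embT A CA i) (embT A CA j) (comulAt A CA p i j a)),
    ← Fin.sum_univ_eq_sum_range (fun i =>
    TensorProduct.map (embT A CA i) (embT A CA (p - i)) (comulAt A CA p i (p - i) a)),
    bigDiag, LinearMap.sum_apply]
  refine Finset.sum_congr rfl fun j _ => ?_
  rw [comulAt_of_eq A CA (by have := j.is_le; omega)]
  rfl

lemma bigDiag_coaug (r : R) : bigDiag A CA 0 (CA.coaug r) = 0 := by
  have h : comulAt A CA 0 0 0 = CA.comul 0 0 := comulAt_add A CA 0 0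
  rw [coaug_eq_smul, map_smul, bigDiag_apply, Finset.HasAntidiagonal.antidiagonal_zero, Finset.sum_singleton, h,
    CA.coaug_grouplike, TensorProduct.map_tmul, embT_coaug, TensorProduct.zero_tmul, smul_zero]

lemma bigD_embT (n : ℕ) (a : A n) : bigD A CA (embT A CA n a) = dRed A CA n a := by
  rw [bigD, embT, LinearMap.comp_apply, DirectSum.toModule_lof]
  cases n with
  | zero => rfl
  | succ n => rfl

lemma bigΔ_embT (n : ℕ) (a : A n) : bigΔ A CA (embT A CA n a) = bigDiag A CA n a := by
  rw [bigΔ, embT, LinearMap.comp_apply, DirectSum.toModule_lof, LinearMap.comp_apply]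
  cases n with
  | zero => rw [sect_toRed_zero, map_sub, bigDiag_coaug, sub_zero]
  | succ n => rfl

end Coalgebra

lemma sum_antidiagonal_assoc {M : Type} [AddCommMonoid M] (p : ℕ)
    (f g : ℕ → ℕ → ℕ → ℕ → M) (h : ∀ i j k, i + j + k = p → f (i + j) k i j = g i (j + k) j k) :
    ∑ nk ∈ Finset.HasAntidiagonal.antidiagonal p,
      ∑ ij ∈ Finset.HasAntidiagonal.antidiagonal nk.1, f nk.1 nk.2 ij.1 ij.2
    = ∑ im ∈ Finset.HasAntidiagonal.antidiagonal p,
      ∑ jk ∈ Finset.HasAntidiagonal.antidiagonal im.2, g im.1 im.2 jk.1 jk.2 := by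
  rw [Finset.sum_sigma', Finset.sum_sigma']
  refine Finset.sum_nbij' (fun s => ⟨(s.2.1, s.2.2 + s.1.2), (s.2.2, s.1.2)⟩)
    (fun s => ⟨(s.1.1 + s.2.1, s.2.2), (s.1.1, s.2.1)⟩) ?_ ?_ ?_ ?_ ?_
  all_goals
    rintro ⟨⟨n, k⟩, i, j⟩ hs
    simp only [Finset.mem_sigma, Finset.HasAntidiagonal.mem_antidiagonal] at hs ⊢
    obtain ⟨rfl, rfl⟩ := hs
  · exact ⟨by omega, trivial⟩
  · exact ⟨by omega, trivial⟩
  · rfl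
  · rfl
  · exact h _ _ _ rfl

section Coalgebra

variable {R : Type} [CommRing R]
variable (A : ℕ → Type) [∀ n, AddCommGroup (A n)] [∀ n, Module R (A n)] (CA : CoalgStr R A)

lemma comulAt_coassoc (i j k n m p : ℕ) (hn : n = i + j) (hm : m = j + k) (hp : p = n + k) (a : A p) :
    TensorProduct.assoc R (A i) (A j) (A k)
      (TensorProduct.map (comulAt A CA n i j) LinearMap.id (comulAt A CA p n k a))
      = TensorProduct.map LinearMap.id (comulAt A CA m j k) (comulAt A CA p i m a) := by
  subst hn hm hp
  rw [comulAt_add, comulAt_add, comulAt_add, comulAt_of_eq A CA (Nat.add_assoc i j k)]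
  exact CA.coassoc i j k a

lemma bigΔ_map_left (i j : ℕ) (t : A i ⊗[R] A j) :
    TensorProduct.assoc R _ _ _ (TensorProduct.map (bigΔ A CA) LinearMap.id
      (TensorProduct.map (embT A CA i) (embT A CA j) t))
    = ∑ kl ∈ Finset.HasAntidiagonal.antidiagonal i,
        TensorProduct.map (embT A CA kl.1) (TensorProduct.map (embT A CA kl.2) (embT A CA j))
          (TensorProduct.assoc R _ _ _
            (TensorProduct.map (comulAt A CA i kl.1 kl.2) LinearMap.id t)) := by
  induction t with
  | zero => simp
  | add x y hx hy => simp only [map_add, Finset.sum_add_distrib, hx, hy]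
  | tmul a a' =>
    simp only [TensorProduct.map_tmul, bigΔ_embT, bigDiag_apply, LinearMap.id_apply,
      TensorProduct.sum_tmul, map_sum]
    refine Finset.sum_congr rfl fun kl _ => ?_
    generalize comulAt A CA i kl.1 kl.2 a = u
    induction u with
    | zero => simp
    | add x y hx hy => simp only [map_add, TensorProduct.add_tmul, hx, hy]
    | tmul => rfl

lemma bigΔ_map_right (i j : ℕ) (t : A i ⊗[R] A j) :
    TensorProduct.map LinearMap.id (bigΔ A CA)
      (TensorProduct.map (embT A CA i) (embT A CA j) t)
    = ∑ kl ∈ Finset.HasAntidiagonal.antidiagonal j,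
        TensorProduct.map (embT A CA i) (TensorProduct.map (embT A CA kl.1) (embT A CA kl.2))
            (TensorProduct.map LinearMap.id (comulAt A CA j kl.1 kl.2) t) := by
  induction t with
  | zero => simp
  | add x y hx hy => simp only [map_add, Finset.sum_add_distrib, hx, hy]
  | tmul a a' =>
    simp only [TensorProduct.map_tmul, bigΔ_embT, bigDiag_apply, LinearMap.id_apply,
      TensorProduct.tmul_sum]

lemma bigΔ_coassoc (y : Big A CA) :
    TensorProduct.assoc R _ _ _ (TensorProduct.map (bigΔ A CA) LinearMap.id (bigΔ A CA y))
      = TensorProduct.map LinearMap.id (bigΔ A CA) (bigΔ A CA y) := by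
  induction y using big_induction with
  | hz => simp
  | hadd x y hx hy => simp only [map_add, hx, hy]
  | hemb p a _ =>
    simp only [bigΔ_embT, bigDiag_apply A CA p, map_sum, bigΔ_map_left, bigΔ_map_right]
    refine sum_antidiagonal_assoc p
      (fun n k i j => TensorProduct.map (embT A CA i) (TensorProduct.map (embT A CA j) (embT A CA k))
        (TensorProduct.assoc R _ _ _
          (TensorProduct.map (comulAt A CA n i j) LinearMap.id (comulAt A CA p n k a))))
      (fun i m j k => TensorProduct.map (embT A CA i)
        (TensorProduct.map (embT A CA j) (embT A CA k))
        (TensorProduct.map LinearMap.id (comulAt A CA m j k) (comulAt A CA p i m a)))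
      fun i j k h => ?_
    rw [comulAt_coassoc A CA i j k _ _ p rfl rfl h.symm]

lemma neg_one_pow_zsmul (R : Type) {M : Type} [CommRing R] [CharP R 2] [AddCommGroup M]
    [Module R M] (k : ℕ) (u : M) : (-1 : ℤ) ^ k • u = u := by
  have h : -u = u := neg_eq_of_add_eq_zero_left (add_self_eq_zero_of_charP R u)
  rcases neg_one_pow_eq_or ℤ k with h' | h' <;> simp [h', h]

lemma comulAt_d [CharP R 2] (i j n : ℕ) (a : A (n + 1)) (hn : n = i + j) :
    comulAt A CA n i j (CA.d n a)
      = TensorProduct.map (CA.d i) LinearMap.id (comulAt A CA (n + 1) (i + 1) j a)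
        + TensorProduct.map LinearMap.id (CA.d j) (comulAt A CA (n + 1) i (j + 1) a) := by
  subst hn
  rw [comulAt_add, CA.coleib, neg_one_pow_zsmul R, comulAt_of_eq A CA (by omega),
    comulAt_of_eq A CA (by omega)]
  rfl

lemma bigD_map_left_zero (j : ℕ) (t : A 0 ⊗[R] A j) :
    TensorProduct.map (bigD A CA) LinearMap.id
      (TensorProduct.map (embT A CA 0) (embT A CA j) t) = 0 := by
  induction t with
  | zero => simp
  | add x y hx hy => simp only [map_add, hx, hy, add_zero]
  | tmul a a' => simp [bigD_embT, dRed]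

lemma bigD_map_right_zero (j : ℕ) (t : A j ⊗[R] A 0) :
    TensorProduct.map LinearMap.id (bigD A CA)
      (TensorProduct.map (embT A CA j) (embT A CA 0) t) = 0 := by
  induction t with
  | zero => simp
  | add x y hx hy => simp only [map_add, hx, hy, add_zero]
  | tmul a a' => simp [bigD_embT, dRed]

lemma bigD_map_left_succ (i j : ℕ) (t : A (i + 1) ⊗[R] A j) :
    TensorProduct.map (bigD A CA) LinearMap.id
      (TensorProduct.map (embT A CA (i + 1)) (embT A CA j) t)
    = TensorProduct.map (embT A CA i) (embT A CA j)
        (TensorProduct.map (CA.d i) LinearMap.id t) := by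
  induction t with
  | zero => simp
  | add x y hx hy => simp only [map_add, hx, hy]
  | tmul a a' => simp [bigD_embT, dRed]

lemma bigD_map_right_succ (i j : ℕ) (t : A i ⊗[R] A (j + 1)) :
    TensorProduct.map LinearMap.id (bigD A CA)
      (TensorProduct.map (embT A CA i) (embT A CA (j + 1)) t)
    = TensorProduct.map (embT A CA i) (embT A CA j)
        (TensorProduct.map LinearMap.id (CA.d j) t) := by
  induction t with
  | zero => simp
  | add x y hx hy => simp only [map_add, hx, hy]
  | tmul a a' => simp [bigD_embT, dRed]

lemma bigΔ_coleib [CharP R 2] (y : Big A CA) :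
    bigΔ A CA (bigD A CA y) = TensorProduct.map (bigD A CA) LinearMap.id (bigΔ A CA y)
      + TensorProduct.map LinearMap.id (bigD A CA) (bigΔ A CA y) := by
  induction y using big_induction with
  | hz => simp
  | hadd x y hx hy => simp only [map_add, hx, hy]; abel
  | hemb p a _ =>
    rw [bigD_embT, bigΔ_embT, bigDiag_apply]
    simp only [map_sum]
    cases p with
    | zero =>
      simp [dRed, bigD_map_left_zero, bigD_map_right_zero]
    | succ n =>
      rw [Finset.Nat.sum_antidiagonal_succ]
      conv_rhs => rw [add_comm]
      rw [Finset.Nat.sum_antidiagonal_succ']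
      simp only [bigD_map_left_zero, bigD_map_right_zero, bigD_map_left_succ, bigD_map_right_succ]
      rw [zero_add, zero_add, ← Finset.sum_add_distrib, dRed, LinearMap.comp_apply, bigΔ_embT,
        bigDiag_apply]
      refine Finset.sum_congr rfl fun ij hij => ?_
      rw [comulAt_d A CA ij.1 ij.2 n a (Finset.HasAntidiagonal.mem_antidiagonal.1 hij).symm, map_add, add_comm]

end Coalgebra

section Coalgebra

variable {R : Type} [CommRing R]
variable (A : ℕ → Type) [∀ n, AddCommGroup (A n)] [∀ n, Module R (A n)] (CA : CoalgStr R A)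

/-- The splitting `A n → R ⊕ Ā` given by the counit and the projection to `Ā`. -/
def augT (n : ℕ) : A n →ₗ[R] R × Big A CA := (epsAt A CA n).prod (embT A CA n)

/-- The full diagonal on `Ā`, with values in `(R ⊕ Ā) ⊗ (R ⊕ Ā)`. -/
def fullΔ : Big A CA →ₗ[R] (R × Big A CA) ⊗[R] (R × Big A CA) :=
  TensorProduct.map (LinearMap.inr R R _) (LinearMap.inr R R _) ∘ₗ bigΔ A CA
  + TensorProduct.mk R _ _ (1, 0) ∘ₗ LinearMap.inr R R _
  + (TensorProduct.mk R _ _).flip (1, 0) ∘ₗ LinearMap.inr R R _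

lemma comulAt_zero_left (p : ℕ) (a : A p) :
    TensorProduct.map CA.counit LinearMap.id (comulAt A CA p 0 p a) = (1 : R) ⊗ₜ[R] a := by
  apply (TensorProduct.lid R (A p)).injective
  rw [comulAt_of_eq A CA (Nat.zero_add p).symm]
  simpa using CA.counit_comul p a

lemma comulAt_zero_right (p : ℕ) (a : A p) :
    TensorProduct.map LinearMap.id CA.counit (comulAt A CA p p 0 a) = a ⊗ₜ[R] (1 : R) := by
  apply (TensorProduct.rid R (A p)).injective
  have : comulAt A CA p p 0 = CA.comul p 0 := comulAt_add A CA p 0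
  rw [this]
  simpa using CA.comul_counit p a

lemma sum_comulAt_eps_left {M N : Type} [AddCommGroup M] [Module R M] [AddCommGroup N] [Module R N]
    (u : R →ₗ[R] M) (f : ∀ n, A n →ₗ[R] N) (p : ℕ) (a : A p) :
    ∑ ij ∈ Finset.HasAntidiagonal.antidiagonal p,
      TensorProduct.map (u ∘ₗ epsAt A CA ij.1) (f ij.2) (comulAt A CA p ij.1 ij.2 a)
    = u 1 ⊗ₜ f p a := by
  rw [Finset.sum_eq_single (0, p)]
  · have := congrArg (TensorProduct.map u (f p)) (comulAt_zero_left A CA p a)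
    rwa [← LinearMap.comp_apply, ← TensorProduct.map_comp, LinearMap.comp_id,
      TensorProduct.map_tmul] at this
  · rintro ⟨i, j⟩ hij hne
    rw [Finset.HasAntidiagonal.mem_antidiagonal] at hij
    cases i with
    | zero => exact absurd (by simpa using hij) hne
    | succ i => simp [epsAt]
  · intro hh
    simp at hh

lemma sum_comulAt_eps_right {M N : Type} [AddCommGroup M] [Module R M] [AddCommGroup N]
    [Module R N] (u : R →ₗ[R] M) (f : ∀ n, A n →ₗ[R] N) (p : ℕ) (a : A p) :
    ∑ ij ∈ Finset.HasAntidiagonal.antidiagonal p,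
      TensorProduct.map (f ij.1) (u ∘ₗ epsAt A CA ij.2) (comulAt A CA p ij.1 ij.2 a)
    = f p a ⊗ₜ u 1 := by
  rw [Finset.sum_eq_single (p, 0)]
  · have := congrArg (TensorProduct.map (f p) u) (comulAt_zero_right A CA p a)
    rwa [← LinearMap.comp_apply, ← TensorProduct.map_comp, LinearMap.comp_id,
      TensorProduct.map_tmul] at this
  · rintro ⟨i, j⟩ hij hne
    rw [Finset.HasAntidiagonal.mem_antidiagonal] at hij
    cases j with
    | zero => exact absurd (by simpa using hij) hne
    | succ i => simp [epsAt]
  · intro hh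
    simp at hh

lemma augT_eq (n : ℕ) : augT A CA n
    = LinearMap.inl R R _ ∘ₗ epsAt A CA n + LinearMap.inr R R _ ∘ₗ embT A CA n := by
  ext a <;> simp [augT]

lemma sum_map_augT (p : ℕ) (a : A p) :
    ∑ ij ∈ Finset.HasAntidiagonal.antidiagonal p,
      TensorProduct.map (augT A CA ij.1) (augT A CA ij.2) (comulAt A CA p ij.1 ij.2 a)
    = fullΔ A CA (embT A CA p a) + (1, 0) ⊗ₜ (epsAt A CA p a, 0) := by
  simp only [augT_eq, TensorProduct.map_add_left, TensorProduct.map_add_right,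
    LinearMap.add_apply, Finset.sum_add_distrib,
    sum_comulAt_eps_left A CA (LinearMap.inl R R (Big A CA))
      (fun n => LinearMap.inr R R (Big A CA) ∘ₗ embT A CA n),
    sum_comulAt_eps_left A CA (LinearMap.inl R R (Big A CA))
      (fun n => LinearMap.inl R R (Big A CA) ∘ₗ epsAt A CA n),
    sum_comulAt_eps_right A CA (LinearMap.inl R R (Big A CA))
      (fun n => LinearMap.inr R R (Big A CA) ∘ₗ embT A CA n)]
  simp only [fullΔ, LinearMap.add_apply, LinearMap.comp_apply, bigΔ_embT, bigDiag_apply, map_sum,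
    TensorProduct.map_comp, TensorProduct.mk_apply, LinearMap.flip_apply, LinearMap.inl_apply,
    LinearMap.inr_apply]
  abel

end Coalgebra

section TwoCoalgebras

variable {R : Type} [CommRing R]
variable (A : ℕ → Type) [∀ n, AddCommGroup (A n)] [∀ n, Module R (A n)] (CA : CoalgStr R A)
variable (B : ℕ → Type) [∀ n, AddCommGroup (B n)] [∀ n, Module R (B n)] (CB : CoalgStr R B)

/-- The letters `[a]`, as a linear map. -/
def letA : Big A CA →ₗ[R] Om A CA B CB := TensorAlgebra.ι R ∘ₗ lA A CA B CB

/-- The letters `[b]`, as a linear map. -/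
def letB : Big B CB →ₗ[R] Om A CA B CB := TensorAlgebra.ι R ∘ₗ lB A CA B CB

/-- The letters `[ab]`, as a linear map. -/
def letT : Big A CA ⊗[R] Big B CB →ₗ[R] Om A CA B CB := TensorAlgebra.ι R ∘ₗ lT A CA B CB

/-- The word of length one on an element of `(R ⊕ Ā) ⊗ (R ⊕ B̄)`. -/
def letFull : (R × Big A CA) ⊗[R] (R × Big B CB) →ₗ[R] Om A CA B CB :=
  letT A CA B CB ∘ₗ TensorProduct.map (LinearMap.snd R R _) (LinearMap.snd R R _)
  + letA A CA B CB ∘ₗ (TensorProduct.rid R _).toLinearMap ∘ₗ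
      TensorProduct.map (LinearMap.snd R R _) (LinearMap.fst R R _)
  + letB A CA B CB ∘ₗ (TensorProduct.lid R _).toLinearMap ∘ₗ
      TensorProduct.map (LinearMap.fst R R _) (LinearMap.snd R R _)

lemma letFull_tmul (u : R × Big A CA) (v : R × Big B CB) :
    letFull A CA B CB (u ⊗ₜ v) = letT A CA B CB (u.2 ⊗ₜ v.2) + v.1 • letA A CA B CB u.2
      + u.1 • letB A CA B CB v.2 := by
  simp [letFull]

lemma ι_Γg (p q : ℕ) (z : A p ⊗[R] B q) : TensorAlgebra.ι R (Γg A CA B CB p q z)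
    = letFull A CA B CB (TensorProduct.map (augT A CA p) (augT B CB q) z) := by
  induction z with
  | zero => simp
  | add x y hx hy => simp only [map_add, hx, hy]
  | tmul a b =>
    rw [TensorProduct.map_tmul, letFull_tmul, ← map_smul, ← map_smul]
    simp only [letA, letB, letT, LinearMap.comp_apply, ← map_add]
    congr 1
    simp [Γg, lA, lB, lT, augT]

/-- The product of the words of length one on the two factors. -/
def mulFull : ((R × Big A CA) ⊗[R] (R × Big A CA)) ⊗[R] ((R × Big B CB) ⊗[R] (R × Big B CB)) →ₗ[R]
    Om A CA B CB :=
  mul2 (letFull A CA B CB) (letFull A CA B CB) ∘ₗ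
    (TensorProduct.tensorTensorTensorComm R _ _ _ _).toLinearMap

lemma mulFull_tmul (u u' : R × Big A CA) (v v' : R × Big B CB) :
    mulFull A CA B CB ((u ⊗ₜ u') ⊗ₜ (v ⊗ₜ v'))
      = letFull A CA B CB (u ⊗ₜ v) * letFull A CA B CB (u' ⊗ₜ v') := rfl

lemma mulFull_map (i j k l : ℕ) (s : A i ⊗[R] A j) (t : B k ⊗[R] B l) :
    mul2 (TensorAlgebra.ι R ∘ₗ Γg A CA B CB i k) (TensorAlgebra.ι R ∘ₗ Γg A CA B CB j l)
      (TensorProduct.tensorTensorTensorComm R (A i) (A j) (B k) (B l) (s ⊗ₜ t))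
    = mulFull A CA B CB (TensorProduct.map (augT A CA i) (augT A CA j) s ⊗ₜ
        TensorProduct.map (augT B CB k) (augT B CB l) t) := by
  induction s with
  | zero => simp
  | add x y hx hy => simp only [TensorProduct.add_tmul, map_add, hx, hy]
  | tmul a a' =>
    induction t with
    | zero => simp
    | add x y hx hy => simp only [TensorProduct.tmul_add, map_add, hx, hy]
    | tmul b b' =>
      simp only [TensorProduct.tensorTensorTensorComm_tmul, mul2_tmul, LinearMap.comp_apply, ι_Γg,
        TensorProduct.map_tmul, mulFull_tmul]

lemma quadT_tmul [CharP R 2] (p q : ℕ) (a : A p) (b : B q) : quadT A CA B CB p q (a ⊗ₜ b)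
    = mulFull A CA B CB ((fullΔ A CA (embT A CA p a) + (1, 0) ⊗ₜ (epsAt A CA p a, 0)) ⊗ₜ
        (fullΔ B CB (embT B CB q b) + (1, 0) ⊗ₜ (epsAt B CB q b, 0))) := by
  rw [← sum_map_augT, ← sum_map_augT, TensorProduct.sum_tmul, map_sum]
  simp only [TensorProduct.tmul_sum, map_sum, ← mulFull_map]
  rw [Finset.Nat.sum_antidiagonal_eq_sum_range_succ_mk, ← Fin.sum_univ_eq_sum_range
    (fun i => ∑ kl ∈ Finset.HasAntidiagonal.antidiagonal q,
      mul2 (TensorAlgebra.ι R ∘ₗ Γg A CA B CB i kl.1)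
        (TensorAlgebra.ι R ∘ₗ Γg A CA B CB (p - i) kl.2)
        (TensorProduct.tensorTensorTensorComm R _ _ _ _
          (comulAt A CA p i (p - i) a ⊗ₜ comulAt B CB q kl.1 kl.2 b)))]
  simp only [quadT, LinearMap.sum_apply]
  refine Finset.sum_congr rfl fun j _ => ?_
  rw [Finset.Nat.sum_antidiagonal_eq_sum_range_succ_mk, ← Fin.sum_univ_eq_sum_range
    (fun k =>
      mul2 (TensorAlgebra.ι R ∘ₗ Γg A CA B CB j.1 k)
        (TensorAlgebra.ι R ∘ₗ Γg A CA B CB (p - j.1) (q - k))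
        (TensorProduct.tensorTensorTensorComm R _ _ _ _
          (comulAt A CA p j.1 (p - j.1) a ⊗ₜ comulAt B CB q k (q - k) b)))]
  refine Finset.sum_congr rfl fun k _ => ?_
  rw [LinearMap.smul_apply, neg_one_pow_zsmul R, comulAt_of_eq A CA (by have := j.is_le; omega),
    comulAt_of_eq B CB (by have := k.is_le; omega)]
  rfl

end TwoCoalgebras

lemma neg_eq_self_of_charP (R : Type) {M : Type} [CommRing R] [CharP R 2] [AddCommGroup M]
    [Module R M] (u : M) : -u = u :=
  neg_eq_of_add_eq_zero_left (add_self_eq_zero_of_charP R u)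

section TwoCoalgebras

variable {R : Type} [CommRing R]
variable (A : ℕ → Type) [∀ n, AddCommGroup (A n)] [∀ n, Module R (A n)] (CA : CoalgStr R A)
variable (B : ℕ → Type) [∀ n, AddCommGroup (B n)] [∀ n, Module R (B n)] (CB : CoalgStr R B)

lemma epsAt_d (n : ℕ) (a : A (n + 1)) : epsAt A CA n (CA.d n a) = 0 := by
  cases n with
  | zero => exact CA.counit_d a
  | succ n => rfl

lemma augT_coaug : augT A CA 0 (CA.coaug 1) = (1, 0) :=
  Prod.ext CA.counit_coaug (embT_coaug A CA 1)

lemma augT_of_epsAt {n : ℕ} {a : A n} (h : epsAt A CA n a = 0) :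
    augT A CA n a = (0, embT A CA n a) := Prod.ext h rfl

lemma genW_tmul (p q : ℕ) (a : A p) (b : B q) :
    genW A CA B CB p q (a ⊗ₜ b) = letFull A CA B CB (augT A CA p a ⊗ₜ augT B CB q b) := by
  rw [genW, ι_Γg, TensorProduct.map_tmul]

lemma linT1_tmul (p q : ℕ) (a : A p) (b : B q) : linT1 A CA B CB p q (a ⊗ₜ b)
    = letFull A CA B CB ((0, bigD A CA (embT A CA p a)) ⊗ₜ augT B CB q b) := by
  rw [bigD_embT]
  cases p with
  | zero => simp [linT1, dRed, letFull_tmul]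
  | succ p =>
    simp only [linT1, LinearMap.comp_apply, ι_Γg, TensorProduct.map_tmul,
      augT_of_epsAt A CA (epsAt_d A CA p a), LinearMap.id_apply, dRed]

lemma linT2_tmul [CharP R 2] (p q : ℕ) (a : A p) (b : B q) : linT2 A CA B CB p q (a ⊗ₜ b)
    = letFull A CA B CB (augT A CA p a ⊗ₜ (0, bigD B CB (embT B CB q b))) := by
  rw [bigD_embT]
  cases q with
  | zero => cases p <;> simp [linT2, dRed, letFull_tmul]
  | succ q =>
    cases p <;>
    simp only [linT2, neg_one_pow_zsmul R, LinearMap.comp_apply, ι_Γg,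
      TensorProduct.map_tmul, augT_of_epsAt B CB (epsAt_d B CB q b), LinearMap.id_apply, dRed]

lemma dvalT_tmul [CharP R 2] (p q : ℕ) (a : A p) (b : B q) : dvalT A CA B CB p q (a ⊗ₜ b)
    = letFull A CA B CB ((0, bigD A CA (embT A CA p a)) ⊗ₜ augT B CB q b)
      + letFull A CA B CB (augT A CA p a ⊗ₜ (0, bigD B CB (embT B CB q b)))
      + mulFull A CA B CB ((fullΔ A CA (embT A CA p a) + (1, 0) ⊗ₜ (epsAt A CA p a, 0)) ⊗ₜ
        (fullΔ B CB (embT B CB q b) + (1, 0) ⊗ₜ (epsAt B CB q b, 0))) := by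
  rw [← linT1_tmul, ← linT2_tmul, ← quadT_tmul]
  simp only [dvalT, LinearMap.add_apply, sub_eq_add_neg,
    neg_eq_self_of_charP R]

lemma letA_embT (p : ℕ) (a : A p) :
    letA A CA B CB (embT A CA p a) = genW A CA B CB p 0 (a ⊗ₜ CB.coaug 1) := by
  rw [genW_tmul, augT_coaug, letFull_tmul]
  simp [augT]

lemma letB_embT (q : ℕ) (b : B q) :
    letB A CA B CB (embT B CB q b) = genW A CA B CB 0 q (CA.coaug 1 ⊗ₜ b) := by
  rw [genW_tmul, augT_coaug, letFull_tmul]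
  simp [augT]

lemma letT_embT (p q : ℕ) (a : A p) (b : B q) (ha : epsAt A CA p a = 0) (hb : epsAt B CB q b = 0) :
    letT A CA B CB (embT A CA p a ⊗ₜ embT B CB q b) = genW A CA B CB p q (a ⊗ₜ b) := by
  simp [genW_tmul, augT_of_epsAt, ha, hb, letFull_tmul]

/-- The part of the differential of `[ab]` involving the reduced diagonal of `a`. -/
def crossTerm : Big A CA ⊗[R] Big A CA →ₗ[R] Big B CB →ₗ[R] Om A CA B CB :=
  ((TensorProduct.mk R _ _).compr₂ (mulFull A CA B CB)).compl₁₂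
    (TensorProduct.map (LinearMap.inr R R _) (LinearMap.inr R R _)) (fullΔ B CB)

lemma mulFull_map_inr (u u' : R × Big A CA) (t : Big B CB ⊗[R] Big B CB) :
    mulFull A CA B CB ((u ⊗ₜ u') ⊗ₜ
      TensorProduct.map (LinearMap.inr R R _) (LinearMap.inr R R _) t)
    = mul2 (letFull A CA B CB ∘ₗ TensorProduct.mk R _ _ u ∘ₗ LinearMap.inr R R _)
        (letFull A CA B CB ∘ₗ TensorProduct.mk R _ _ u' ∘ₗ LinearMap.inr R R _) t := by
  induction t with
  | zero => simp
  | add x y hx hy => simp only [map_add, TensorProduct.tmul_add, hx, hy]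
  | tmul b b' => rfl

lemma letFull_mk_zero (x : Big A CA) :
    letFull A CA B CB ∘ₗ TensorProduct.mk R _ _ (0, x) ∘ₗ LinearMap.inr R R _
      = letT A CA B CB ∘ₗ TensorProduct.mk R _ _ x := by
  ext y
  simp [letFull_tmul]

lemma letFull_mk_one :
    letFull A CA B CB ∘ₗ TensorProduct.mk R _ _ (1, 0) ∘ₗ LinearMap.inr R R _
      = letB A CA B CB := by
  ext y
  simp [letFull_tmul]

lemma mulFull_fullΔ_right (u u' : R × Big A CA) (y : Big B CB) :
    mulFull A CA B CB ((u ⊗ₜ u') ⊗ₜ fullΔ B CB y)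
    = mul2 (letFull A CA B CB ∘ₗ TensorProduct.mk R _ _ u ∘ₗ LinearMap.inr R R _)
        (letFull A CA B CB ∘ₗ TensorProduct.mk R _ _ u' ∘ₗ LinearMap.inr R R _) (bigΔ B CB y)
      + letFull A CA B CB (u ⊗ₜ (1, 0)) * letFull A CA B CB (u' ⊗ₜ (0, y))
      + letFull A CA B CB (u ⊗ₜ (0, y)) * letFull A CA B CB (u' ⊗ₜ (1, 0)) := by
  simp only [fullΔ, LinearMap.add_apply, LinearMap.comp_apply, TensorProduct.tmul_add, map_add,
    mulFull_map_inr, TensorProduct.mk_apply, LinearMap.flip_apply, mulFull_tmul,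
    LinearMap.inr_apply]

lemma crossTerm_tmul (x x' : Big A CA) (y : Big B CB) :
    crossTerm A CA B CB (x ⊗ₜ x') y
      = letT A CA B CB (x ⊗ₜ y) * letA A CA B CB x' + letA A CA B CB x * letT A CA B CB (x' ⊗ₜ y)
        + mul2 (letT A CA B CB ∘ₗ TensorProduct.mk R _ _ x)
            (letT A CA B CB ∘ₗ TensorProduct.mk R _ _ x') (bigΔ B CB y) := by
  have : crossTerm A CA B CB (x ⊗ₜ x') y
      = mulFull A CA B CB (((0, x) ⊗ₜ (0, x')) ⊗ₜ fullΔ B CB y) := rfl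
  rw [this, mulFull_fullΔ_right, letFull_mk_zero, letFull_mk_zero]
  simp [letFull_tmul]
  abel

lemma mulFull_fullΔ (x : Big A CA) (y : Big B CB) :
    mulFull A CA B CB (fullΔ A CA x ⊗ₜ fullΔ B CB y)
    = letA A CA B CB x * letB A CA B CB y + letB A CA B CB y * letA A CA B CB x
    + mul2 (letT A CA B CB ∘ₗ TensorProduct.mk R _ _ x) (letB A CA B CB) (bigΔ B CB y)
    + mul2 (letB A CA B CB) (letT A CA B CB ∘ₗ TensorProduct.mk R _ _ x) (bigΔ B CB y)
    + crossTerm A CA B CB (bigΔ A CA x) y := by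
  rw [fullΔ, LinearMap.add_apply, LinearMap.add_apply, TensorProduct.add_tmul,
    TensorProduct.add_tmul, map_add, map_add]
  simp only [LinearMap.comp_apply, TensorProduct.mk_apply, LinearMap.flip_apply,
    LinearMap.inr_apply, mulFull_fullΔ_right, letFull_mk_zero, letFull_mk_one]
  have : mulFull A CA B CB (TensorProduct.map (LinearMap.inr R R _) (LinearMap.inr R R _)
    (bigΔ A CA x) ⊗ₜ fullΔ B CB y) = crossTerm A CA B CB (bigΔ A CA x) y := rfl
  rw [this]
  simp [letFull_tmul]
  abel

lemma mulFull_fullΔ_one (x : Big A CA) :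
    mulFull A CA B CB (fullΔ A CA x ⊗ₜ ((1, 0) ⊗ₜ (1, 0)))
      = mul2 (letA A CA B CB) (letA A CA B CB) (bigΔ A CA x) := by
  rw [fullΔ, LinearMap.add_apply, LinearMap.add_apply, TensorProduct.add_tmul,
    TensorProduct.add_tmul, map_add, map_add]
  simp only [LinearMap.comp_apply, TensorProduct.mk_apply, LinearMap.flip_apply,
    LinearMap.inr_apply, mulFull_tmul]
  generalize bigΔ A CA x = t
  have h : ∀ t : Big A CA ⊗[R] Big A CA,
      mulFull A CA B CB (TensorProduct.map (LinearMap.inr R R _) (LinearMap.inr R R _) t ⊗ₜ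
        ((1, 0) ⊗ₜ (1, 0))) = mul2 (letA A CA B CB) (letA A CA B CB) t := by
    intro t
    induction t with
    | zero => simp
    | add x y hx hy => simp only [map_add, TensorProduct.add_tmul, hx, hy]
    | tmul => simp [mulFull_tmul, mul2_tmul, letFull_tmul]
  rw [h]
  simp [letFull_tmul]

lemma mulFull_one_fullΔ (y : Big B CB) :
    mulFull A CA B CB (((1, 0) ⊗ₜ (1, 0)) ⊗ₜ fullΔ B CB y)
      = mul2 (letB A CA B CB) (letB A CA B CB) (bigΔ B CB y) := by
  rw [mulFull_fullΔ_right, letFull_mk_one]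
  simp [letFull_tmul]

end TwoCoalgebras

section Induction

variable {R M : Type} [CommRing R] [AddCommGroup M] [Module R M]

lemma tensorAlgebra_mem_of_left (S : Submodule R (TensorAlgebra R M)) (h1 : 1 ∈ S)
    (hι : ∀ m, ∀ u ∈ S, TensorAlgebra.ι R m * u ∈ S) (u : TensorAlgebra R M) : u ∈ S := by
  have key : ∀ v : TensorAlgebra R M, ∀ u ∈ S, v * u ∈ S := by
    intro v
    induction v using TensorAlgebra.induction with
    | algebraMap r =>
      intro u hu
      rw [← Algebra.smul_def]
      exact S.smul_mem r hu
    | ι m => exact hι m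
    | mul a b ha hb =>
      intro u hu
      rw [mul_assoc]
      exact ha _ (hb _ hu)
    | add a b ha hb =>
      intro u hu
      rw [add_mul]
      exact S.add_mem (ha _ hu) (hb _ hu)
  simpa using key u 1 h1

lemma tensorAlgebra_mem_of_right (S : Submodule R (TensorAlgebra R M)) (h1 : 1 ∈ S)
    (hι : ∀ m, ∀ u ∈ S, u * TensorAlgebra.ι R m ∈ S) (u : TensorAlgebra R M) : u ∈ S := by
  have key : ∀ v : TensorAlgebra R M, ∀ u ∈ S, u * v ∈ S := by
    intro v
    induction v using TensorAlgebra.induction with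
    | algebraMap r =>
      intro u hu
      rw [← Algebra.commutes, ← Algebra.smul_def]
      exact S.smul_mem r hu
    | ι m => exact hι m
    | mul a b ha hb =>
      intro u hu
      rw [← mul_assoc]
      exact hb _ (ha _ hu)
    | add a b ha hb =>
      intro u hu
      rw [mul_add]
      exact S.add_mem (ha _ hu) (hb _ hu)
  simpa using key u 1 h1

end Induction

section TwoCoalgebras

variable {R : Type} [CommRing R]
variable (A : ℕ → Type) [∀ n, AddCommGroup (A n)] [∀ n, Module R (A n)] (CA : CoalgStr R A)
variable (B : ℕ → Type) [∀ n, AddCommGroup (B n)] [∀ n, Module R (B n)] (CB : CoalgStr R B)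

lemma om_mem (S : Submodule R (Om A CA B CB)) (h1 : 1 ∈ S)
    (hA : ∀ x, ∀ u ∈ S, letA A CA B CB x * u ∈ S) (hB : ∀ y, ∀ u ∈ S, letB A CA B CB y * u ∈ S)
    (hT : ∀ x y, ∀ u ∈ S, letT A CA B CB (x ⊗ₜ y) * u ∈ S) (u : Om A CA B CB) : u ∈ S := by
  refine tensorAlgebra_mem_of_left S h1 ?_ u
  rintro ⟨t, x, y⟩ u hu
  have : TensorAlgebra.ι R (t, x, y) = letT A CA B CB t + letA A CA B CB x + letB A CA B CB y := by
    simp only [letA, letB, letT, LinearMap.comp_apply, ← map_add]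
    congr 1
    simp [lA, lB, lT]
  rw [this, add_mul, add_mul]
  refine S.add_mem (S.add_mem ?_ (hA x u hu)) (hB y u hu)
  clear this
  induction t with
  | zero => simp
  | add a b ha hb =>
    rw [map_add, add_mul]
    exact S.add_mem ha hb
  | tmul x y => exact hT x y u hu

/-- The defining properties of the cobar differential. -/
def IsCobarDiff (d : Om A CA B CB →ₗ[R] Om A CA B CB) : Prop :=
  d 1 = 0 ∧ ∀ (p q : ℕ) (z : A p ⊗[R] B q) (u : Om A CA B CB),
    d (genW A CA B CB p q z * u) = dvalT A CA B CB p q z * u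
      + ((-1 : ℤ)^(p+q+1)) • (genW A CA B CB p q z * d u)

lemma one_tmul_mk_zero {M : Type} [AddCommGroup M] [Module R M] :
    ((1, 0) : R × M) ⊗ₜ[R] ((0, 0) : R × M) = 0 := TensorProduct.tmul_zero _ _

namespace IsCobarDiff

variable {A CA B CB}
variable {d : Om A CA B CB →ₗ[R] Om A CA B CB}

lemma apply_genW (hd : IsCobarDiff A CA B CB d) (p q : ℕ) (z : A p ⊗[R] B q) :
    d (genW A CA B CB p q z) = dvalT A CA B CB p q z := by
  simpa [hd.1] using hd.2 p q z 1

lemma genW_mul [CharP R 2] (hd : IsCobarDiff A CA B CB d) (p q : ℕ) (z : A p ⊗[R] B q)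
    (u : Om A CA B CB) : d (genW A CA B CB p q z * u)
      = d (genW A CA B CB p q z) * u + genW A CA B CB p q z * d u := by
  rw [hd.2, hd.apply_genW, neg_one_pow_zsmul R]

lemma letA_mul [CharP R 2] (hd : IsCobarDiff A CA B CB d) (x : Big A CA) (u : Om A CA B CB) :
    d (letA A CA B CB x * u) = d (letA A CA B CB x) * u + letA A CA B CB x * d u := by
  induction x using big_induction with
  | hz => simp
  | hadd x y hx hy => simp only [map_add, add_mul, hx, hy]; abel
  | hemb p a _ => rw [letA_embT, hd.genW_mul]

lemma letB_mul [CharP R 2] (hd : IsCobarDiff A CA B CB d) (x : Big B CB) (u : Om A CA B CB) :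
    d (letB A CA B CB x * u) = d (letB A CA B CB x) * u + letB A CA B CB x * d u := by
  induction x using big_induction with
  | hz => simp
  | hadd x y hx hy => simp only [map_add, add_mul, hx, hy]; abel
  | hemb p a _ => rw [letB_embT, hd.genW_mul]

lemma letT_mul [CharP R 2] (hd : IsCobarDiff A CA B CB d) (x : Big A CA) (y : Big B CB)
    (u : Om A CA B CB) : d (letT A CA B CB (x ⊗ₜ y) * u)
      = d (letT A CA B CB (x ⊗ₜ y)) * u + letT A CA B CB (x ⊗ₜ y) * d u := by
  induction x using big_induction with
  | hz => simp
  | hadd x y hx hy => simp only [TensorProduct.add_tmul, map_add, add_mul, hx, hy]; abel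
  | hemb p a ha =>
    induction y using big_induction with
    | hz => simp
    | hadd x y hx hy => simp only [TensorProduct.tmul_add, map_add, add_mul, hx, hy]; abel
    | hemb q b hb => rw [letT_embT _ _ _ _ _ _ _ _ ha hb, hd.genW_mul]

lemma map_mul [CharP R 2] (hd : IsCobarDiff A CA B CB d) (u v : Om A CA B CB) :
    d (u * v) = d u * v + u * d v := by
  have := om_mem A CA B CB (LinearMap.eqLocus (d ∘ₗ LinearMap.mulRight R v)
    (LinearMap.mulRight R v ∘ₗ d + LinearMap.mulRight R (d v))) ?_ ?_ ?_ ?_ u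
  · exact this
  all_goals simp only [LinearMap.mem_eqLocus, LinearMap.comp_apply, LinearMap.add_apply,
    LinearMap.mulRight_apply]
  · simp [hd.1]
  · intro x u hu
    simp only [hd.letA_mul, mul_assoc, hu, mul_add, add_mul, add_assoc]
  · intro x u hu
    simp only [hd.letB_mul, mul_assoc, hu, mul_add, add_mul, add_assoc]
  · intro x y u hu
    simp only [hd.letT_mul, mul_assoc, hu, mul_add, add_mul, add_assoc]

lemma apply_letA [CharP R 2] (hd : IsCobarDiff A CA B CB d) (x : Big A CA) :
    d (letA A CA B CB x) = letA A CA B CB (bigD A CA x)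
      + mul2 (letA A CA B CB) (letA A CA B CB) (bigΔ A CA x) := by
  induction x using big_induction with
  | hz => simp
  | hadd x y hx hy => simp only [map_add, hx, hy]; abel
  | hemb p a ha =>
    have h1 : epsAt B CB 0 (CB.coaug 1) = 1 := CB.counit_coaug
    rw [letA_embT, hd.apply_genW, dvalT_tmul, embT_coaug, augT_of_epsAt A CA ha, ha, h1,
      augT_coaug, map_zero, map_zero, zero_add, one_tmul_mk_zero,
      add_zero, ← mulFull_fullΔ_one A CA B CB]
    simp [letFull_tmul]

lemma apply_letB [CharP R 2] (hd : IsCobarDiff A CA B CB d) (y : Big B CB) :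
    d (letB A CA B CB y) = letB A CA B CB (bigD B CB y)
      + mul2 (letB A CA B CB) (letB A CA B CB) (bigΔ B CB y) := by
  induction y using big_induction with
  | hz => simp
  | hadd x y hx hy => simp only [map_add, hx, hy]; abel
  | hemb p b hb =>
    have h1 : epsAt A CA 0 (CA.coaug 1) = 1 := CA.counit_coaug
    rw [letB_embT, hd.apply_genW, dvalT_tmul, embT_coaug, augT_of_epsAt B CB hb, hb, h1,
      augT_coaug, map_zero, map_zero, zero_add, one_tmul_mk_zero, add_zero,
      ← mulFull_one_fullΔ A CA B CB]
    simp [letFull_tmul]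

lemma apply_letT [CharP R 2] (hd : IsCobarDiff A CA B CB d) (x : Big A CA) (y : Big B CB) :
    d (letT A CA B CB (x ⊗ₜ y)) = letT A CA B CB (bigD A CA x ⊗ₜ y)
      + letT A CA B CB (x ⊗ₜ bigD B CB y)
      + mulFull A CA B CB (fullΔ A CA x ⊗ₜ fullΔ B CB y) := by
  induction x using big_induction with
  | hz => simp
  | hadd x y hx hy => simp only [TensorProduct.add_tmul, map_add, hx, hy]; abel
  | hemb p a ha =>
    induction y using big_induction with
    | hz => simp
    | hadd x y hx hy => simp only [TensorProduct.tmul_add, map_add, hx, hy]; abel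
    | hemb q b hb =>
      rw [letT_embT _ _ _ _ _ _ _ _ ha hb, hd.apply_genW, dvalT_tmul, ha, hb,
        augT_of_epsAt A CA ha, augT_of_epsAt B CB hb, one_tmul_mk_zero, one_tmul_mk_zero, add_zero, add_zero]
      simp [letFull_tmul]

end IsCobarDiff

lemma qMil_letA (x : Big A CA) : qMil A CA B CB (letA A CA B CB x) = TensorAlgebra.ι R x ⊗ₜ 1 := by
  simp [qMil, letA, lA, qgen]

lemma qMil_letB (y : Big B CB) : qMil A CA B CB (letB A CA B CB y) = 1 ⊗ₜ TensorAlgebra.ι R y := by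
  simp [qMil, letB, lB, qgen]

lemma qMil_letT (t : Big A CA ⊗[R] Big B CB) : qMil A CA B CB (letT A CA B CB t) = 0 := by
  simp [qMil, letT, lT, qgen]

lemma OiA_ι (x : Big A CA) : OiA A CA B CB (TensorAlgebra.ι R x) = letA A CA B CB x := by
  simp [OiA, letA]

lemma OiB_ι (y : Big B CB) : OiB A CA B CB (TensorAlgebra.ι R y) = letB A CA B CB y := by
  simp [OiB, letB]

lemma sigmaMil_tmul (u : OmA A CA) (v : OmB B CB) :
    sigmaMil A CA B CB (u ⊗ₜ v) = OiA A CA B CB u * OiB A CA B CB v := rfl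

lemma qMil_OiA (u : OmA A CA) : qMil A CA B CB (OiA A CA B CB u) = u ⊗ₜ 1 := by
  have : (qMil A CA B CB).comp (OiA A CA B CB) = Algebra.TensorProduct.includeLeft := by
    refine TensorAlgebra.hom_ext (LinearMap.ext fun x => ?_)
    simp [OiA_ι, qMil_letA]
  exact DFunLike.congr_fun this u

lemma qMil_OiB (v : OmB B CB) : qMil A CA B CB (OiB A CA B CB v) = 1 ⊗ₜ v := by
  have : (qMil A CA B CB).comp (OiB A CA B CB) = Algebra.TensorProduct.includeRight := by
    refine TensorAlgebra.hom_ext (LinearMap.ext fun x => ?_)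
    simp [OiB_ι, qMil_letB]
  exact DFunLike.congr_fun this v

lemma qMil_sigmaMil (z : OmA A CA ⊗[R] OmB B CB) :
    qMil A CA B CB (sigmaMil A CA B CB z) = z := by
  induction z with
  | zero => simp
  | add x y hx hy => rw [map_add, map_add, hx, hy]
  | tmul u v => simp [sigmaMil_tmul, qMil_OiA, qMil_OiB]

lemma qMil_comm (x : Big A CA) (y : Big B CB) :
    qMil A CA B CB (letB A CA B CB y) * qMil A CA B CB (letA A CA B CB x)
      = qMil A CA B CB (letA A CA B CB x) * qMil A CA B CB (letB A CA B CB y) := by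
  simp [qMil_letA, qMil_letB]

lemma sigmaMil_one : sigmaMil A CA B CB 1 = 1 := by
  simp [Algebra.TensorProduct.one_def, sigmaMil_tmul]

lemma sigmaMil_letA_mul (x : Big A CA) (z : OmA A CA ⊗[R] OmB B CB) :
    sigmaMil A CA B CB (qMil A CA B CB (letA A CA B CB x) * z)
      = letA A CA B CB x * sigmaMil A CA B CB z := by
  induction z with
  | zero => simp
  | add x y hx hy => simp only [mul_add, map_add, hx, hy]
  | tmul u v => simp [qMil_letA, sigmaMil_tmul, OiA_ι, mul_assoc]

lemma sigmaMil_mul_letB (z : OmA A CA ⊗[R] OmB B CB) (y : Big B CB) :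
    sigmaMil A CA B CB (z * qMil A CA B CB (letB A CA B CB y))
      = sigmaMil A CA B CB z * letB A CA B CB y := by
  induction z with
  | zero => simp
  | add x y hx hy => simp only [add_mul, map_add, hx, hy]
  | tmul u v => simp [qMil_letB, sigmaMil_tmul, OiB_ι, mul_assoc]

lemma omTensor_mem (S : Submodule R (OmA A CA ⊗[R] OmB B CB)) (h1 : 1 ∈ S)
    (hA : ∀ x, ∀ z ∈ S, qMil A CA B CB (letA A CA B CB x) * z ∈ S)
    (hB : ∀ y, ∀ z ∈ S, z * qMil A CA B CB (letB A CA B CB y) ∈ S)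
    (z : OmA A CA ⊗[R] OmB B CB) : z ∈ S := by
  induction z with
  | zero => exact S.zero_mem
  | add x y hx hy => exact S.add_mem hx hy
  | tmul u v =>
    refine tensorAlgebra_mem_of_left (S.comap ((TensorProduct.mk R _ _).flip v)) ?_ ?_ u
    · refine tensorAlgebra_mem_of_right (S.comap (TensorProduct.mk R _ _ 1)) h1 ?_ v
      intro y w hw
      simpa [qMil_letB] using hB y _ hw
    · intro x w hw
      simpa [qMil_letA] using hA x _ hw

end TwoCoalgebras

section Coalgebra

variable {R : Type} [CommRing R]
variable (A : ℕ → Type) [∀ n, AddCommGroup (A n)] [∀ n, Module R (A n)] (CA : CoalgStr R A)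

lemma wordAlg_cons (t : (p : ℕ) × A p) (l : List ((p : ℕ) × A p)) :
    wordAlg A CA (t :: l) = TensorAlgebra.ι R (embT A CA t.1 t.2) * wordAlg A CA l := rfl

lemma mem_of_wordAlg (S : Submodule R (OmA A CA)) (hS : ∀ l, wordAlg A CA l ∈ S)
    (u : OmA A CA) : u ∈ S := by
  have key : ∀ u, u ∈ Submodule.span R (Set.range (wordAlg A CA)) := by
    refine tensorAlgebra_mem_of_left _ (Submodule.subset_span ⟨[], rfl⟩) ?_
    intro m u hu
    induction m using big_induction with
    | hz => simp
    | hadd x y hx hy =>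
      rw [map_add, add_mul]
      exact Submodule.add_mem _ hx hy
    | hemb n a _ =>
      induction hu using Submodule.span_induction with
      | mem w hw =>
        obtain ⟨l, rfl⟩ := hw
        exact Submodule.subset_span ⟨⟨n, a⟩ :: l, rfl⟩
      | zero => simp
      | add v w _ _ hv hw =>
        rw [mul_add]
        exact Submodule.add_mem _ hv hw
      | smul r v _ hv =>
        rw [mul_smul_comm]
        exact Submodule.smul_mem _ r hv
  refine Submodule.span_le.2 ?_ (key u)
  rintro _ ⟨l, rfl⟩
  exact hS l

end Coalgebra

section TwoCoalgebras

variable {R : Type} [CommRing R]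
variable (A : ℕ → Type) [∀ n, AddCommGroup (A n)] [∀ n, Module R (A n)] (CA : CoalgStr R A)
variable (B : ℕ → Type) [∀ n, AddCommGroup (B n)] [∀ n, Module R (B n)] (CB : CoalgStr R B)

lemma wordAlg_tmul_induction {P : OmA A CA ⊗[R] OmB B CB → Prop} (z : OmA A CA ⊗[R] OmB B CB)
    (hadd : ∀ x y, P x → P y → P (x + y)) (hsmul : ∀ (r : R) x, P x → P (r • x))
    (hw : ∀ α β, P (wordAlg A CA α ⊗ₜ wordAlg B CB β)) : P z := by
  let S : Submodule R (OmA A CA ⊗[R] OmB B CB) :=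
    { carrier := {z | P z}
      add_mem' := fun {x y} hx hy => hadd x y hx hy
      zero_mem' := by simpa using hsmul 0 _ (hw [] [])
      smul_mem' := fun r x hx => hsmul r x hx }
  have key : z ∈ S := by
    induction z with
    | zero => exact S.zero_mem
    | add x y hx hy => exact S.add_mem hx hy
    | tmul u v =>
      refine mem_of_wordAlg A CA (S.comap ((TensorProduct.mk R _ _).flip v)) (fun α => ?_) u
      exact mem_of_wordAlg B CB (S.comap (TensorProduct.mk R _ _ (wordAlg A CA α)))
        (fun β => hw α β) v
  exact key

lemma OiA_wordAlg (l : List ((p : ℕ) × A p)) :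
    OiA A CA B CB (wordAlg A CA l) = wordA A CA B CB l := by
  induction l with
  | nil => exact map_one _
  | cons t l ih =>
    rw [wordAlg_cons, _root_.map_mul, ih, OiA_ι]
    rfl

lemma OiB_wordAlg (l : List ((q : ℕ) × B q)) :
    OiB A CA B CB (wordAlg B CB l) = wordB A CA B CB l := by
  induction l with
  | nil => exact map_one _
  | cons t l ih =>
    rw [wordAlg_cons, _root_.map_mul, ih, OiB_ι]
    rfl

lemma sigmaMil_wordAlg (α : List ((p : ℕ) × A p)) (β : List ((q : ℕ) × B q)) :
    sigmaMil A CA B CB (wordAlg A CA α ⊗ₜ wordAlg B CB β)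
      = wordA A CA B CB α * wordB A CA B CB β := by
  rw [sigmaMil_tmul, OiA_wordAlg, OiB_wordAlg]

/-- The recursion characterizing the natural homotopy. -/
structure IsNaturalHomotopy (h : Om A CA B CB →ₗ[R] Om A CA B CB) : Prop where
  base : ∀ (p q : ℕ) (a : A p) (b : B q),
    h (genB A CA B CB (embT B CB q b) * genA A CA B CB (embT A CA p a))
      = genT A CA B CB (embT A CA p a ⊗ₜ[R] embT B CB q b)
  rec1 : ∀ (q : ℕ) (b : B q) (α : List ((p : ℕ) × A p)) (x : Big A CA),
    h (genB A CA B CB (embT B CB q b) * wordA A CA B CB α * genA A CA B CB x)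
      = wordA A CA B CB α * genT A CA B CB (x ⊗ₜ[R] embT B CB q b)
        + h (genB A CA B CB (embT B CB q b) * wordA A CA B CB α) * genA A CA B CB x
        + sweedC A CA B CB h α x (bigDiag B CB q b)
  rec2 : ∀ (ω : Om A CA B CB) (q : ℕ) (b : B q) (α : List ((p : ℕ) × A p)),
    α ≠ [] → ∀ β : List ((r : ℕ) × B r),
    h (ω * genB A CA B CB (embT B CB q b) * wordA A CA B CB α * wordB A CA B CB β)
      = ω * h (genB A CA B CB (embT B CB q b) * wordA A CA B CB α) * wordB A CA B CB β
        + h (ω * wordA A CA B CB α * genB A CA B CB (embT B CB q b) * wordB A CA B CB β)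
  zero1 : ∀ (α : List ((p : ℕ) × A p)) (β : List ((r : ℕ) × B r)),
    h (wordA A CA B CB α * wordB A CA B CB β) = 0
  zero2 : ∀ (ω : Om A CA B CB) (t : Big A CA ⊗[R] Big B CB)
      (α : List ((p : ℕ) × A p)) (β : List ((r : ℕ) × B r)),
    h (ω * genT A CA B CB t * wordA A CA B CB α * wordB A CA B CB β) = 0

variable {A CA B CB}

lemma genA_eq (x : Big A CA) : genA A CA B CB x = letA A CA B CB x := rfl
lemma genB_eq (y : Big B CB) : genB A CA B CB y = letB A CA B CB y := rfl
lemma genT_eq (t : Big A CA ⊗[R] Big B CB) : genT A CA B CB t = letT A CA B CB t := rfl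

lemma wordA_nil : wordA A CA B CB [] = 1 := rfl
lemma wordB_nil : wordB A CA B CB [] = 1 := rfl

lemma wordA_cons (t : (p : ℕ) × A p) (l : List ((p : ℕ) × A p)) :
    wordA A CA B CB (t :: l) = letA A CA B CB (embT A CA t.1 t.2) * wordA A CA B CB l := rfl

lemma wordB_cons (t : (p : ℕ) × B p) (l : List ((p : ℕ) × B p)) :
    wordB A CA B CB (t :: l) = letB A CA B CB (embT B CB t.1 t.2) * wordB A CA B CB l := rfl

lemma wordA_concat (l : List ((p : ℕ) × A p)) (t : (p : ℕ) × A p) :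
    wordA A CA B CB (l ++ [t]) = wordA A CA B CB l * letA A CA B CB (embT A CA t.1 t.2) := by
  simp [wordA, genA_eq]

lemma wordB_concat (l : List ((p : ℕ) × B p)) (t : (p : ℕ) × B p) :
    wordB A CA B CB (l ++ [t]) = wordB A CA B CB l * letB A CA B CB (embT B CB t.1 t.2) := by
  simp [wordB, genB_eq]

namespace IsNaturalHomotopy

variable {h : Om A CA B CB →ₗ[R] Om A CA B CB}

lemma apply_sigmaMil (H : IsNaturalHomotopy A CA B CB h) (z : OmA A CA ⊗[R] OmB B CB) :
    h (sigmaMil A CA B CB z) = 0 := by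
  induction z using wordAlg_tmul_induction with
  | hadd x y hx hy => rw [map_add, map_add, hx, hy, add_zero]
  | hsmul r x hx => rw [map_smul, map_smul, hx, smul_zero]
  | hw α β => rw [sigmaMil_wordAlg, H.zero1]

lemma mul_letT_sigmaMil (H : IsNaturalHomotopy A CA B CB h) (w : Om A CA B CB)
    (t : Big A CA ⊗[R] Big B CB) (z : OmA A CA ⊗[R] OmB B CB) :
    h (w * letT A CA B CB t * sigmaMil A CA B CB z) = 0 := by
  induction z using wordAlg_tmul_induction with
  | hadd x y hx hy => rw [map_add, mul_add, map_add, hx, hy, add_zero]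
  | hsmul r x hx => rw [map_smul, mul_smul_comm, map_smul, hx, smul_zero]
  | hw α β => rw [sigmaMil_wordAlg, ← mul_assoc, ← genT_eq, H.zero2]

lemma wordB_eq_zero (H : IsNaturalHomotopy A CA B CB h) (β : List ((q : ℕ) × B q)) :
    h (wordB A CA B CB β) = 0 := by
  simpa [wordA_nil] using H.zero1 [] β

lemma apply_letB (H : IsNaturalHomotopy A CA B CB h) (y : Big B CB) :
    h (letB A CA B CB y) = 0 := by
  induction y using big_induction with
  | hz => simp
  | hadd x y hx hy => rw [map_add, map_add, hx, hy, add_zero]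
  | hemb q b _ => simpa [wordB_cons, wordB_nil] using H.wordB_eq_zero [⟨q, b⟩]

lemma letB_word (H : IsNaturalHomotopy A CA B CB h) (y : Big B CB) (α : List ((p : ℕ) × A p))
    (β : List ((q : ℕ) × B q)) :
    h (letB A CA B CB y * (wordA A CA B CB α * wordB A CA B CB β))
      = h (letB A CA B CB y * wordA A CA B CB α) * wordB A CA B CB β := by
  induction y using big_induction with
  | hz => simp
  | hadd x y hx hy => simp only [map_add, add_mul, hx, hy]
  | hemb q b _ =>
    have hB := H.wordB_eq_zero (⟨q, b⟩ :: β)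
    rw [wordB_cons] at hB
    by_cases hα : α = []
    · rw [hα, wordA_nil, one_mul, mul_one, H.apply_letB, zero_mul, hB]
    · have h1 := H.rec2 1 q b α hα β
      have h2 := H.zero1 α (⟨q, b⟩ :: β)
      rw [wordB_cons] at h2
      simp only [one_mul, genB_eq, mul_assoc] at h1 h2 ⊢
      rw [h1, h2, add_zero]

lemma letB_sigmaMil_letB (H : IsNaturalHomotopy A CA B CB h) (y : Big B CB)
    (z : OmA A CA ⊗[R] OmB B CB) (y' : Big B CB) :
    h (letB A CA B CB y * sigmaMil A CA B CB z * letB A CA B CB y')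
      = h (letB A CA B CB y * sigmaMil A CA B CB z) * letB A CA B CB y' := by
  induction z using wordAlg_tmul_induction with
  | hadd x y hx hy => simp only [map_add, mul_add, add_mul, hx, hy]
  | hsmul r x hx => simp only [map_smul, mul_smul_comm, smul_mul_assoc, hx]
  | hw α β =>
    induction y' using big_induction with
    | hz => simp
    | hadd x y hx hy => simp only [map_add, mul_add, hx, hy]
    | hemb q b _ =>
      have h1 := H.letB_word y α (β ++ [⟨q, b⟩])
      rw [wordB_concat] at h1
      rw [sigmaMil_wordAlg, H.letB_word]
      simp only [mul_assoc] at h1 ⊢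
      exact h1

lemma mul_letB_sigmaMil (H : IsNaturalHomotopy A CA B CB h) (w : Om A CA B CB) (y : Big B CB)
    (z : OmA A CA ⊗[R] OmB B CB) :
    h (w * (letB A CA B CB y * sigmaMil A CA B CB z))
      = w * h (letB A CA B CB y * sigmaMil A CA B CB z)
        + h (w * sigmaMil A CA B CB (qMil A CA B CB (letB A CA B CB y) * z)) := by
  induction z using wordAlg_tmul_induction with
  | hadd x y hx hy => simp only [map_add, mul_add, hx, hy]; abel
  | hsmul r x hx => simp only [map_smul, mul_smul_comm, hx, smul_add]
  | hw α β =>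
    rw [qMil_letB, Algebra.TensorProduct.tmul_mul_tmul, one_mul, sigmaMil_tmul, sigmaMil_tmul,
      _root_.map_mul (OiB A CA B CB), OiA_wordAlg, OiB_wordAlg, OiB_ι, H.letB_word]
    induction y using big_induction with
    | hz => simp
    | hadd x y hx hy => simp only [map_add, mul_add, add_mul, hx, hy]; abel
    | hemb q b _ =>
      by_cases hα : α = []
      · rw [hα, wordA_nil, one_mul, mul_one, one_mul, H.apply_letB, zero_mul, mul_zero, zero_add]
      · have h1 := H.rec2 w q b α hα β
        simp only [genB_eq, mul_assoc] at h1 ⊢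
        exact h1

lemma letB_wordA_letA (H : IsNaturalHomotopy A CA B CB h) (y : Big B CB)
    (α : List ((p : ℕ) × A p)) (x : Big A CA) :
    h (letB A CA B CB y * (wordA A CA B CB α * letA A CA B CB x))
      = wordA A CA B CB α * letT A CA B CB (x ⊗ₜ y)
        + h (letB A CA B CB y * wordA A CA B CB α) * letA A CA B CB x
        + mul2 (h ∘ₗ LinearMap.mulRight R (wordA A CA B CB α) ∘ₗ letB A CA B CB)
            (letT A CA B CB ∘ₗ TensorProduct.mk R _ _ x) (bigΔ B CB y) := by
  induction y using big_induction with
  | hz => simp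
  | hadd x y hx hy => simp only [map_add, TensorProduct.tmul_add, mul_add, add_mul, hx, hy]; abel
  | hemb q b _ =>
    rw [bigΔ_embT, ← mul_assoc]
    exact H.rec1 q b α x

lemma letB_letA_wordA (H : IsNaturalHomotopy A CA B CB h) (α : List ((p : ℕ) × A p))
    (p : ℕ) (a : A p) (y : Big B CB) :
    h (letB A CA B CB y * (letA A CA B CB (embT A CA p a) * wordA A CA B CB α))
      = letA A CA B CB (embT A CA p a) * h (letB A CA B CB y * wordA A CA B CB α)
        + letT A CA B CB (embT A CA p a ⊗ₜ y) * wordA A CA B CB α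
        + mul2 (letT A CA B CB ∘ₗ TensorProduct.mk R _ _ (embT A CA p a))
          (h ∘ₗ LinearMap.mulRight R (wordA A CA B CB α) ∘ₗ letB A CA B CB) (bigΔ B CB y) := by
  induction α using List.reverseRecOn generalizing y with
  | nil =>
    have h1 := H.letB_wordA_letA y [] (embT A CA p a)
    have h2 : h ∘ₗ LinearMap.mulRight R (1 : Om A CA B CB) ∘ₗ letB A CA B CB = 0 := by
      refine LinearMap.ext fun y => ?_
      simp [H.apply_letB]
    have h3 : ∀ (f : Big B CB →ₗ[R] Om A CA B CB) t, mul2 f (0 : Big B CB →ₗ[R] Om A CA B CB) t = 0 :=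
      fun f t => by
        induction t with
        | zero => simp
        | add x y hx hy => rw [map_add, hx, hy, add_zero]
        | tmul u v => simp [mul2_tmul]
    have h4 : ∀ (f : Big B CB →ₗ[R] Om A CA B CB) t, mul2 (0 : Big B CB →ₗ[R] Om A CA B CB) f t = 0 :=
      fun f t => by
        induction t with
        | zero => simp
        | add x y hx hy => rw [map_add, hx, hy, add_zero]
        | tmul u v => simp [mul2_tmul]
    rw [wordA_nil, h2, h4] at h1
    rw [wordA_nil, h2, h3, mul_one, mul_one, mul_one, H.apply_letB, mul_zero, zero_add, add_zero]
    simpa [H.apply_letB] using h1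
  | append_singleton α c ih =>
    obtain ⟨S, hS⟩ := TensorProduct.exists_finset (bigΔ B CB y)
    have h1 := H.letB_wordA_letA y (⟨p, a⟩ :: α) (embT A CA c.1 c.2)
    have h2 := sum_coassoc_mul (bigΔ_coassoc B CB y) hS
      (letT A CA B CB ∘ₗ TensorProduct.mk R _ _ (embT A CA p a))
      (h ∘ₗ LinearMap.mulRight R (wordA A CA B CB α) ∘ₗ letB A CA B CB)
      (letT A CA B CB ∘ₗ TensorProduct.mk R _ _ (embT A CA c.1 c.2))
    rw [wordA_cons] at h1
    rw [wordA_concat, ← mul_assoc (letA A CA B CB (embT A CA p a)), h1, ih,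
      H.letB_wordA_letA, hS]
    simp only [map_sum, mul2_tmul, LinearMap.comp_apply, LinearMap.mulRight_apply, ih,
      H.letB_wordA_letA] at h2 ⊢
    simp only [TensorProduct.mk_apply, add_mul, mul_add, Finset.sum_add_distrib, Finset.mul_sum,
      Finset.sum_mul, mul_assoc] at h2 ⊢
    rw [h2]
    abel

lemma letB_letA_sigmaMil (H : IsNaturalHomotopy A CA B CB h) (x : Big A CA) (y : Big B CB)
    (z : OmA A CA ⊗[R] OmB B CB) :
    h (letB A CA B CB y * (letA A CA B CB x * sigmaMil A CA B CB z))
      = letA A CA B CB x * h (letB A CA B CB y * sigmaMil A CA B CB z)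
        + letT A CA B CB (x ⊗ₜ y) * sigmaMil A CA B CB z
        + mul2 (letT A CA B CB ∘ₗ TensorProduct.mk R _ _ x)
          (h ∘ₗ LinearMap.mulRight R (sigmaMil A CA B CB z) ∘ₗ letB A CA B CB) (bigΔ B CB y) := by
  obtain ⟨S, hS⟩ := TensorProduct.exists_finset (bigΔ B CB y)
  simp only [hS, map_sum, mul2_tmul, LinearMap.comp_apply, LinearMap.mulRight_apply,
    TensorProduct.mk_apply]
  induction z using wordAlg_tmul_induction with
  | hadd x y hx hy => simp only [map_add, mul_add, hx, hy, Finset.sum_add_distrib]; abel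
  | hsmul r x hx => simp only [map_smul, mul_smul_comm, hx, smul_add, Finset.smul_sum]
  | hw α β =>
    induction x using big_induction with
    | hz => simp
    | hadd x y hx hy =>
      simp only [map_add, TensorProduct.add_tmul, mul_add, add_mul, hx, hy,
        Finset.sum_add_distrib]
      abel
    | hemb p a _ =>
      have h1 := H.letB_word y (⟨p, a⟩ :: α) β
      rw [wordA_cons] at h1
      simp only [sigmaMil_wordAlg, H.letB_word]
      rw [← mul_assoc (letA A CA B CB _), h1, H.letB_letA_wordA, hS]
      simp only [map_sum, mul2_tmul, LinearMap.comp_apply, LinearMap.mulRight_apply,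
        TensorProduct.mk_apply, add_mul, Finset.sum_mul, mul_assoc]

end IsNaturalHomotopy

/-- The homotopy data given by the cobar differential and the natural homotopy. -/
def homotopyData [CharP R 2] {d h : Om A CA B CB →ₗ[R] Om A CA B CB}
    (hd : IsCobarDiff A CA B CB d) (H : IsNaturalHomotopy A CA B CB h) :
    HomotopyData R (Big A CA) (Big B CB) (Om A CA B CB) (OmA A CA ⊗[R] OmB B CB) where
  gA := letA A CA B CB
  gB := letB A CA B CB
  gT := letT A CA B CB
  q := qMil A CA B CB
  sec := sigmaMil A CA B CB
  d := d
  h := h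
  δA := bigD A CA
  ΔA := bigΔ A CA
  δB := bigD B CB
  ΔB := bigΔ B CB
  crossA := crossTerm A CA B CB
  crossA_tmul := crossTerm_tmul A CA B CB
  d_mul := hd.map_mul
  d_gA := hd.apply_letA
  d_gB := hd.apply_letB
  d_gT x y := by
    rw [hd.apply_letT, mulFull_fullΔ]
    simp only [add_assoc]
  coassoc := bigΔ_coassoc B CB
  coleib := bigΔ_coleib B CB
  q_gT := qMil_letT A CA B CB
  q_sec := qMil_sigmaMil A CA B CB
  q_comm := qMil_comm A CA B CB
  sec_one := sigmaMil_one A CA B CB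
  sec_gA := sigmaMil_letA_mul A CA B CB
  sec_gB := sigmaMil_mul_letB A CA B CB
  ind := om_mem A CA B CB
  indQ := omTensor_mem A CA B CB
  h_sec := H.apply_sigmaMil
  h_gT_sec := H.mul_letT_sigmaMil
  h_mul_gB_sec := H.mul_letB_sigmaMil
  h_gB_sec_gB := H.letB_sigmaMil_letB
  h_gB_gA_sec := H.letB_letA_sigmaMil

end TwoCoalgebras

/-- Let `A`, `B` be coaugmented chain coalgebras over a commutative
ring `R` of characteristic 2.  The natural degree `+1` map `h` on `Ω(A ⊗ B)` is a chain
homotopy from `σq` to the identity:  `dh + hd = σq + 1` on all of `Ω (A ⊗ B)`,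
where `q` is the Milgram map and `σ` its natural section. -/
theorem homotopy_is_chain_homotopy
    (R : Type) [CommRing R] [CharP R 2]
    (A : ℕ → Type) [∀ n, AddCommGroup (A n)] [∀ n, Module R (A n)] (CA : CoalgStr R A)
    (B : ℕ → Type) [∀ n, AddCommGroup (B n)] [∀ n, Module R (B n)] (CB : CoalgStr R B)
    -- the cobar differential of Ω (A ⊗ B)
    (dOm : Om A CA B CB →ₗ[R] Om A CA B CB)
    (hdOm1 : dOm 1 = 0)
    (hdOmL : ∀ (p q : ℕ) (z : A p ⊗[R] B q) (u : Om A CA B CB),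
      dOm (genW A CA B CB p q z * u)
        = dvalT A CA B CB p q z * u
          + ((-1 : ℤ)^(p+q+1)) • (genW A CA B CB p q z * dOm u))
    -- the natural homotopy h, characterized by its defining recursion (mod 2)
    (h : Om A CA B CB →ₗ[R] Om A CA B CB)
    (hh1 : h 1 = 0)
    (hhEnd : ∀ (u : Om A CA B CB) (t : Big A CA ⊗[R] Big B CB), h (u * genT A CA B CB t) = 0)
    (hhBase : ∀ (p q : ℕ) (a : A p) (b : B q),
      h (genB A CA B CB (embT B CB q b) * genA A CA B CB (embT A CA p a))
        = genT A CA B CB (embT A CA p a ⊗ₜ[R] embT B CB q b))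
    (hhRec1 : ∀ (q : ℕ) (b : B q) (α : List ((p : ℕ) × A p)) (x : Big A CA),
      h (genB A CA B CB (embT B CB q b) * wordA A CA B CB α * genA A CA B CB x)
        = wordA A CA B CB α * genT A CA B CB (x ⊗ₜ[R] embT B CB q b)
          + h (genB A CA B CB (embT B CB q b) * wordA A CA B CB α) * genA A CA B CB x
          + sweedC A CA B CB h α x (bigDiag B CB q b))
    (hhRec2 : ∀ (ω : Om A CA B CB) (q : ℕ) (b : B q) (α : List ((p : ℕ) × A p)),
      α ≠ [] → ∀ β : List ((r : ℕ) × B r),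
      h (ω * genB A CA B CB (embT B CB q b) * wordA A CA B CB α * wordB A CA B CB β)
        = ω * h (genB A CA B CB (embT B CB q b) * wordA A CA B CB α) * wordB A CA B CB β
          + h (ω * wordA A CA B CB α * genB A CA B CB (embT B CB q b) * wordB A CA B CB β))
    (hhZero1 : ∀ (α : List ((p : ℕ) × A p)) (β : List ((r : ℕ) × B r)),
      h (wordA A CA B CB α * wordB A CA B CB β) = 0)
    (hhZero2 : ∀ (ω : Om A CA B CB) (t : Big A CA ⊗[R] Big B CB)
        (α : List ((p : ℕ) × A p)) (β : List ((r : ℕ) × B r)),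
      h (ω * genT A CA B CB t * wordA A CA B CB α * wordB A CA B CB β) = 0)
    : ∀ w : Om A CA B CB,
      dOm (h w) + h (dOm w) = sigmaMil A CA B CB (qMil A CA B CB w) + w := by
  exact fun w => (homotopyData (d := dOm) ⟨hdOm1, hdOmL⟩
    ⟨hhBase, hhRec1, hhRec2, hhZero1, hhZero2⟩).homotopy w

end CJ2
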